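/- For integers m, n ≥ 1, the set of continuous quasiconvex functions f : ℝ^{m×n} → ℝ of linear growth is separable for the metric d(f,g) = sup_z |f(z)−g(z)|/(1+|z|) if and only if min(m,n) = 1. -/

import Mathlib

open MeasureTheory

/-- The open unit cube `(0,1)^n` in `ℝⁿ`. -/
def unitCube (n : ℕ) : Set (Fin n → ℝ) := Set.univ.pi fun _ => Set.Ioo (0 : ℝ) 1

/-- The Jacobian matrix of a map `φ : ℝⁿ → ℝᵐ` at a point `x`. -/
noncomputable def jacobianMatrix {m n : ℕ} (φ : (Fin n → ℝ) → (Fin m → ℝ))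
    (x : Fin n → ℝ) : Matrix (Fin m) (Fin n) ℝ :=
  Matrix.of fun i j => fderiv ℝ φ x (Pi.single j 1) i

/-- A continuous function on `m×n` matrices is quasiconvex if it satisfies Jensen's
inequality against gradients of smooth compactly supported test maps on the unit cube. -/
def IsQuasiconvex {m n : ℕ} (f : Matrix (Fin m) (Fin n) ℝ → ℝ) : Prop :=
  ∀ z : Matrix (Fin m) (Fin n) ℝ, ∀ φ : (Fin n → ℝ) → (Fin m → ℝ),
    ContDiff ℝ (⊤ : ℕ∞) φ → HasCompactSupport φ → tsupport φ ⊆ unitCube n →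
    f z ≤ ∫ x in unitCube n, f (z + jacobianMatrix φ x)

/-- The Euclidean (Frobenius) norm of a matrix. -/
noncomputable def frobNorm {m n : ℕ} (z : Matrix (Fin m) (Fin n) ℝ) : ℝ :=
  Real.sqrt (∑ i, ∑ j, (z i j) ^ 2)

/-- `f` has linear growth. -/
def HasLinearGrowth {m n : ℕ} (f : Matrix (Fin m) (Fin n) ℝ → ℝ) : Prop :=
  ∃ C : ℝ, 0 ≤ C ∧ ∀ z, |f z| ≤ C * (1 + frobNorm z)

/-- The metric `d(f,g) = sup_z |f(z)-g(z)|/(1+|z|)` on functions of linear growth. -/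
noncomputable def dLG {m n : ℕ} (f g : Matrix (Fin m) (Fin n) ℝ → ℝ) : ℝ :=
  ⨆ z : Matrix (Fin m) (Fin n) ℝ, |f z - g z| / (1 + frobNorm z)

/-- Average of `g` over the unit square. -/
noncomputable def squareAvg (g : ℝ → ℝ → ℝ) : ℝ :=
  ∫ x in (0 : ℝ)..1, ∫ y in (0 : ℝ)..1, g x y

/-- Average of `g` over the half `y ≤ x` of the unit square. -/
noncomputable def lowerRightAvg (g : ℝ → ℝ → ℝ) : ℝ :=
  2 * ∫ x in (0 : ℝ)..1, ∫ y in (0 : ℝ)..x, g x y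

/-- Average of `g` over the half `x + y ≤ 1` of the unit square. -/
noncomputable def lowerLeftAvg (g : ℝ → ℝ → ℝ) : ℝ :=
  2 * ∫ x in (0 : ℝ)..1, ∫ y in (0 : ℝ)..(1 - x), g x y

/-- Restriction of `g` to a dyadic subsquare, rescaled to the unit square. -/
noncomputable def dyadicRestrict (g : ℝ → ℝ → ℝ) (a b : ℝ) : ℝ → ℝ → ℝ :=
  fun x y => g ((x + a) / 2) ((y + b) / 2)

lemma integral_zero_one_eq_dyadic {k : ℝ → ℝ} (hk : Continuous k) :
    ∫ x in (0 : ℝ)..1, k x =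
      (∫ x in (0 : ℝ)..1, k (x / 2)) / 2 + (∫ x in (0 : ℝ)..1, k ((x + 1) / 2)) / 2 := by
  have h1 : ∫ x in (0 : ℝ)..1, k (x / 2) = 2 * ∫ x in (0 : ℝ)..(1 / 2), k x := by
    rw [intervalIntegral.integral_comp_div (f := k) (by norm_num : (2 : ℝ) ≠ 0)]
    simp
  have h2 : ∫ x in (0 : ℝ)..1, k ((x + 1) / 2) = 2 * ∫ x in (1 / 2 : ℝ)..1, k x := by
    have : ∀ x : ℝ, (x + 1) / 2 = x / 2 + 1 / 2 := fun x => by ring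
    simp_rw [this]
    rw [intervalIntegral.integral_comp_div_add (f := k) (by norm_num : (2 : ℝ) ≠ 0)]
    norm_num
  rw [h1, h2, ← intervalIntegral.integral_add_adjacent_intervals
    (hk.intervalIntegrable 0 (1 / 2)) (hk.intervalIntegrable (1 / 2) 1)]
  ring

lemma continuous_integral_zero_to {g : ℝ → ℝ → ℝ} (hg : Continuous fun p : ℝ × ℝ => g p.1 p.2)
    {s t : ℝ → ℝ} (hs : Continuous s) (ht : Continuous t) :
    Continuous fun x => ∫ y in s x..t x, g x y := by
  have h0 : ∀ t : ℝ → ℝ, Continuous t → Continuous fun x => ∫ y in (0 : ℝ)..t x, g x y :=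
    fun t ht => intervalIntegral.continuous_parametric_intervalIntegral_of_continuous
      (f := g) hg ht
  have : (fun x => ∫ y in s x..t x, g x y) =
      fun x => (∫ y in (0 : ℝ)..t x, g x y) - ∫ y in (0 : ℝ)..s x, g x y := by
    funext x
    have hx : Continuous (g x) := hg.comp (by fun_prop : Continuous fun y => (x, y))
    rw [intervalIntegral.integral_interval_sub_left] <;> exact hx.intervalIntegrable _ _
  rw [this]
  exact (h0 t ht).sub (h0 s hs)

lemma continuous_section {g : ℝ → ℝ → ℝ} (hg : Continuous fun p : ℝ × ℝ => g p.1 p.2) (x : ℝ) :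
    Continuous (g x) := hg.comp (by fun_prop : Continuous fun y => (x, y))

lemma continuous_dyadicRestrict {g : ℝ → ℝ → ℝ} (hg : Continuous fun p : ℝ × ℝ => g p.1 p.2)
    (a b : ℝ) : Continuous fun p : ℝ × ℝ => dyadicRestrict g a b p.1 p.2 :=
  hg.comp (by fun_prop : Continuous fun p : ℝ × ℝ => ((p.1 + a) / 2, (p.2 + b) / 2))

lemma squareAvg_eq_dyadic {g : ℝ → ℝ → ℝ} (hg : Continuous fun p : ℝ × ℝ => g p.1 p.2) :
    squareAvg g = (squareAvg (dyadicRestrict g 0 0) + squareAvg (dyadicRestrict g 1 0) +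
      squareAvg (dyadicRestrict g 0 1) + squareAvg (dyadicRestrict g 1 1)) / 4 := by
  have inner : ∀ x, ∫ y in (0 : ℝ)..1, g x y =
      (∫ y in (0 : ℝ)..1, g x (y / 2)) / 2 + (∫ y in (0 : ℝ)..1, g x ((y + 1) / 2)) / 2 :=
    fun x => integral_zero_one_eq_dyadic (continuous_section hg x)
  have hc : ∀ s t : ℝ, Continuous fun x => ∫ y in (0 : ℝ)..1, g ((x + s) / 2) ((y + t) / 2) :=
    fun s t => continuous_integral_zero_to (g := fun x y => g ((x + s) / 2) ((y + t) / 2))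
      (continuous_dyadicRestrict hg s t) continuous_const continuous_const
  have hI : ∀ s t : ℝ, IntervalIntegrable
      (fun x => (∫ y in (0 : ℝ)..1, g ((x + s) / 2) ((y + t) / 2)) / 2) volume 0 1 :=
    fun s t => ((hc s t).div_const 2).intervalIntegrable _ _
  unfold squareAvg dyadicRestrict
  rw [integral_zero_one_eq_dyadic (continuous_integral_zero_to hg continuous_const
    continuous_const)]
  simp_rw [inner]
  have e1 := intervalIntegral.integral_add (hI 0 0) (hI 0 1)
  have e2 := intervalIntegral.integral_add (hI 1 0) (hI 1 1)
  simp only [add_zero, intervalIntegral.integral_div] at e1 e2 ⊢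
  rw [e1, e2]
  ring

lemma lowerRightAvg_eq_dyadic {g : ℝ → ℝ → ℝ} (hg : Continuous fun p : ℝ × ℝ => g p.1 p.2) :
    lowerRightAvg g = (lowerRightAvg (dyadicRestrict g 0 0) +
      lowerRightAvg (dyadicRestrict g 1 1) + 2 * squareAvg (dyadicRestrict g 1 0)) / 4 := by
  have inner1 : ∀ x, ∫ y in (0 : ℝ)..x / 2, g (x / 2) y =
      (∫ y in (0 : ℝ)..x, g (x / 2) (y / 2)) / 2 := by
    intro x
    rw [intervalIntegral.integral_comp_div (f := fun y => g (x / 2) y)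
      (by norm_num : (2 : ℝ) ≠ 0)]
    simp
  have inner2 : ∀ x, ∫ y in (0 : ℝ)..(x + 1) / 2, g ((x + 1) / 2) y =
      (∫ y in (0 : ℝ)..1, g ((x + 1) / 2) (y / 2)) / 2 +
      (∫ y in (0 : ℝ)..x, g ((x + 1) / 2) ((y + 1) / 2)) / 2 := by
    intro x
    have hx := continuous_section hg ((x + 1) / 2)
    have : ∀ x : ℝ, (x + 1) / 2 = x / 2 + 1 / 2 := fun x => by ring
    rw [intervalIntegral.integral_comp_div (f := fun y => g ((x + 1) / 2) y)
      (by norm_num : (2 : ℝ) ≠ 0),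
      ← intervalIntegral.integral_add_adjacent_intervals
      (hx.intervalIntegrable 0 (1 / 2)) (hx.intervalIntegrable (1 / 2) _)]
    have h3 : ∫ y in (0 : ℝ)..x, g ((x + 1) / 2) ((y + 1) / 2) =
        2 * ∫ y in (1 / 2 : ℝ)..(x + 1) / 2, g ((x + 1) / 2) y := by
      have h4 := intervalIntegral.integral_comp_div_add (a := 0) (b := x)
        (fun y => g ((x + 1) / 2) y) (by norm_num : (2 : ℝ) ≠ 0) (1 / 2)
      simp only [smul_eq_mul, zero_div, zero_add] at h4
      rw [← this x] at h4
      simpa only [this] using h4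
    rw [h3]
    simp
  have hc : ∀ s t : ℝ, ∀ u : ℝ → ℝ, Continuous u →
      Continuous fun x => ∫ y in (0 : ℝ)..u x, g ((x + s) / 2) ((y + t) / 2) :=
    fun s t u hu => continuous_integral_zero_to (g := fun x y => g ((x + s) / 2) ((y + t) / 2))
      (continuous_dyadicRestrict hg s t) continuous_const hu
  unfold lowerRightAvg squareAvg dyadicRestrict
  rw [integral_zero_one_eq_dyadic (continuous_integral_zero_to hg continuous_const
    continuous_id')]
  simp_rw [inner2, inner1]
  have e2 := intervalIntegral.integral_add
    (((hc 1 0 (fun _ => 1) continuous_const).div_const 2).intervalIntegrable (μ := volume) 0 1)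
    (((hc 1 1 (fun x => x) continuous_id').div_const 2).intervalIntegrable 0 1)
  simp only [add_zero, intervalIntegral.integral_div] at e2 ⊢
  rw [e2]
  ring

lemma lowerLeftAvg_eq_lowerRightAvg (g : ℝ → ℝ → ℝ) :
    lowerLeftAvg g = lowerRightAvg fun x y => g (1 - x) y := by
  unfold lowerLeftAvg lowerRightAvg
  have := intervalIntegral.integral_comp_sub_left (a := 0) (b := 1)
    (fun x => ∫ y in (0 : ℝ)..(1 - x), g x y) 1
  simp only [sub_sub_cancel, sub_self, sub_zero] at this
  rw [this]

lemma squareAvg_reflect (g : ℝ → ℝ → ℝ) :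
    squareAvg (fun x y => g (1 - x) y) = squareAvg g := by
  unfold squareAvg
  have := intervalIntegral.integral_comp_sub_left (a := 0) (b := 1)
    (fun x => ∫ y in (0 : ℝ)..1, g x y) 1
  simpa using this

lemma lowerLeftAvg_eq_dyadic {g : ℝ → ℝ → ℝ} (hg : Continuous fun p : ℝ × ℝ => g p.1 p.2) :
    lowerLeftAvg g = (lowerLeftAvg (dyadicRestrict g 1 0) +
      lowerLeftAvg (dyadicRestrict g 0 1) + 2 * squareAvg (dyadicRestrict g 0 0)) / 4 := by
  have hr : ∀ s t, dyadicRestrict (fun x y => g (1 - x) y) s t =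
      fun x y => dyadicRestrict g (1 - s) t (1 - x) y := by
    intro s t
    funext x y
    simp only [dyadicRestrict]
    congr 1
    ring
  rw [lowerLeftAvg_eq_lowerRightAvg, lowerRightAvg_eq_dyadic
    (show Continuous fun p : ℝ × ℝ => g (1 - p.1) p.2 from hg.comp
      (by fun_prop : Continuous fun p : ℝ × ℝ => (1 - p.1, p.2))), hr, hr, hr, squareAvg_reflect,
    lowerLeftAvg_eq_lowerRightAvg, lowerLeftAvg_eq_lowerRightAvg]
  simp

lemma integral_square_swap {g : ℝ → ℝ → ℝ} (hg : Continuous fun p : ℝ × ℝ => g p.1 p.2) :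
    ∫ x in (0 : ℝ)..1, ∫ y in (0 : ℝ)..1, g x y = ∫ y in (0 : ℝ)..1, ∫ x in (0 : ℝ)..1, g x y := by
  simp only [intervalIntegral.integral_of_le zero_le_one]
  apply integral_integral_swap
  rw [Measure.prod_restrict]
  exact (hg.continuousOn.integrableOn_compact (isCompact_Icc.prod isCompact_Icc)).mono_set
    (Set.prod_mono Set.Ioc_subset_Icc_self Set.Ioc_subset_Icc_self)

lemma integral_triangle_swap {g : ℝ → ℝ → ℝ} (hg : Continuous fun p : ℝ × ℝ => g p.1 p.2) :
    ∫ x in (0 : ℝ)..1, ∫ y in (0 : ℝ)..x, g x y = ∫ y in (0 : ℝ)..1, ∫ x in y..1, g x y := by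
  have h1 : ∀ x ∈ Set.Ioc (0 : ℝ) 1, ∫ y in (0 : ℝ)..x, g x y =
      ∫ y in Set.Ioc (0 : ℝ) 1, {p : ℝ × ℝ | p.2 ≤ p.1}.indicator (fun p => g p.1 p.2) (x, y) := by
    intro x hx
    rw [intervalIntegral.integral_of_le hx.1.le,
      ← integral_indicator measurableSet_Ioc, ← integral_indicator measurableSet_Ioc]
    congr 1
    funext y
    simp only [Set.indicator, Set.mem_Ioc, Set.mem_ofPred_eq]
    have := hx.2
    split_ifs <;> grind
  have h2 : ∀ y ∈ Set.Ioc (0 : ℝ) 1, ∫ x in y..1, g x y =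
      ∫ x in Set.Ioc (0 : ℝ) 1, {p : ℝ × ℝ | p.2 ≤ p.1}.indicator (fun p => g p.1 p.2) (x, y) := by
    intro y hy
    rw [intervalIntegral.integral_of_le hy.2, ← integral_Icc_eq_integral_Ioc,
      ← integral_indicator measurableSet_Icc, ← integral_indicator measurableSet_Ioc]
    congr 1
    funext x
    simp only [Set.indicator, Set.mem_Ioc, Set.mem_Icc, Set.mem_ofPred_eq]
    have := hy.1
    split_ifs <;> grind
  rw [intervalIntegral.integral_of_le zero_le_one, intervalIntegral.integral_of_le zero_le_one,
    setIntegral_congr_fun measurableSet_Ioc h1, setIntegral_congr_fun measurableSet_Ioc h2]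
  apply integral_integral_swap (f := fun x y =>
    {p : ℝ × ℝ | p.2 ≤ p.1}.indicator (fun p => g p.1 p.2) (x, y))
  rw [Measure.prod_restrict]
  exact ((hg.continuousOn.integrableOn_compact (isCompact_Icc.prod isCompact_Icc)).mono_set
    (Set.prod_mono Set.Ioc_subset_Icc_self Set.Ioc_subset_Icc_self)).indicator
    (isClosed_le continuous_snd continuous_fst).measurableSet

/-- A continuously differentiable function of two real variables, with its partial derivatives. -/
structure PlaneFun where
  val : ℝ → ℝ → ℝ
  dx : ℝ → ℝ → ℝ
  dy : ℝ → ℝ → ℝ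
  cont : Continuous fun p : ℝ × ℝ => val p.1 p.2
  cont_dx : Continuous fun p : ℝ × ℝ => dx p.1 p.2
  cont_dy : Continuous fun p : ℝ × ℝ => dy p.1 p.2
  hasDeriv_dx : ∀ x y, HasDerivAt (fun s => val s y) (dx x y) x
  hasDeriv_dy : ∀ x y, HasDerivAt (val x) (dy x y) y

namespace PlaneFun

/-- Restriction of a function to a dyadic subsquare, rescaled to the unit square. -/
noncomputable def child (f : PlaneFun) (a b : ℝ) : PlaneFun where
  val x y := 2 * f.val ((x + a) / 2) ((y + b) / 2)
  dx := dyadicRestrict f.dx a b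
  dy := dyadicRestrict f.dy a b
  cont := (continuous_dyadicRestrict f.cont a b).const_mul 2
  cont_dx := continuous_dyadicRestrict f.cont_dx a b
  cont_dy := continuous_dyadicRestrict f.cont_dy a b
  hasDeriv_dx x y := by
    have h := (HasDerivAt.scomp (h := fun s : ℝ => (s + a) / 2) x
      (f.hasDeriv_dx ((x + a) / 2) ((y + b) / 2))
      (((hasDerivAt_id x).add_const a).div_const 2)).const_mul 2
    refine h.congr_deriv ?_
    simp [dyadicRestrict]
  hasDeriv_dy x y := by
    have h := (HasDerivAt.scomp (h := fun s : ℝ => (s + b) / 2) y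
      (f.hasDeriv_dy ((x + a) / 2) ((y + b) / 2))
      (((hasDerivAt_id y).add_const b).div_const 2)).const_mul 2
    refine h.congr_deriv ?_
    simp [dyadicRestrict]

/-- Average along the bottom edge of the unit square. -/
noncomputable def bottom (f : PlaneFun) : ℝ := ∫ x in (0 : ℝ)..1, f.val x 0

/-- Average along the top edge of the unit square. -/
noncomputable def top (f : PlaneFun) : ℝ := ∫ x in (0 : ℝ)..1, f.val x 1

/-- Average along the left edge of the unit square. -/
noncomputable def left (f : PlaneFun) : ℝ := ∫ y in (0 : ℝ)..1, f.val 0 y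

/-- Average along the right edge of the unit square. -/
noncomputable def right (f : PlaneFun) : ℝ := ∫ y in (0 : ℝ)..1, f.val 1 y

/-- Average along the diagonal of the unit square. -/
noncomputable def diag (f : PlaneFun) : ℝ := ∫ x in (0 : ℝ)..1, f.val x x

/-- Average along the antidiagonal of the unit square. -/
noncomputable def antidiag (f : PlaneFun) : ℝ :=
  ∫ x in (0 : ℝ)..1, f.val x (1 - x)

variable (f : PlaneFun)

lemma integral_dx (y a b : ℝ) : ∫ x in a..b, f.dx x y = f.val b y - f.val a y :=
  intervalIntegral.integral_eq_sub_of_hasDerivAt (fun x _ => f.hasDeriv_dx x y)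
    ((f.cont_dx.comp (by fun_prop : Continuous fun x : ℝ => (x, y))).intervalIntegrable _ _)

lemma integral_dy (x a b : ℝ) : ∫ y in a..b, f.dy x y = f.val x b - f.val x a :=
  intervalIntegral.integral_eq_sub_of_hasDerivAt (fun y _ => f.hasDeriv_dy x y)
    ((f.cont_dy.comp (by fun_prop : Continuous fun y : ℝ => (x, y))).intervalIntegrable _ _)

lemma intervalIntegrable_path {s t : ℝ → ℝ} (hs : Continuous s) (ht : Continuous t) :
    IntervalIntegrable (fun x => f.val (s x) (t x)) volume 0 1 :=
  (f.cont.comp (by fun_prop : Continuous fun x : ℝ => (s x, t x))).intervalIntegrable _ _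

lemma squareAvg_dy : squareAvg f.dy = f.top - f.bottom := by
  simp only [squareAvg, integral_dy, top, bottom]
  exact intervalIntegral.integral_sub
    (f.intervalIntegrable_path continuous_id' continuous_const)
    (f.intervalIntegrable_path continuous_id' continuous_const)

lemma squareAvg_dx : squareAvg f.dx = f.right - f.left := by
  rw [squareAvg, integral_square_swap f.cont_dx]
  simp only [integral_dx, right, left]
  exact intervalIntegral.integral_sub
    (f.intervalIntegrable_path continuous_const continuous_id')
    (f.intervalIntegrable_path continuous_const continuous_id')

lemma lowerRightAvg_dy : lowerRightAvg f.dy = 2 * (f.diag - f.bottom) := by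
  simp only [lowerRightAvg, integral_dy, diag, bottom]
  rw [← intervalIntegral.integral_sub
    (f.intervalIntegrable_path continuous_id' continuous_id')
    (f.intervalIntegrable_path continuous_id' continuous_const)]

lemma lowerRightAvg_dx : lowerRightAvg f.dx = 2 * (f.right - f.diag) := by
  rw [lowerRightAvg, integral_triangle_swap f.cont_dx]
  simp only [integral_dx, right, diag]
  rw [← intervalIntegral.integral_sub
    (f.intervalIntegrable_path continuous_const continuous_id')
    (f.intervalIntegrable_path continuous_id' continuous_id')]

lemma lowerLeftAvg_dy : lowerLeftAvg f.dy = 2 * (f.antidiag - f.bottom) := by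
  simp only [lowerLeftAvg, integral_dy, antidiag, bottom]
  rw [← intervalIntegral.integral_sub
    (f.intervalIntegrable_path continuous_id' (by fun_prop : Continuous fun x : ℝ => 1 - x))
    (f.intervalIntegrable_path continuous_id' continuous_const)]

lemma lowerLeftAvg_dx : lowerLeftAvg f.dx = 2 * (f.antidiag - f.left) := by
  have hc : Continuous fun p : ℝ × ℝ => f.dx (1 - p.1) p.2 :=
    f.cont_dx.comp (by fun_prop : Continuous fun p : ℝ × ℝ => (1 - p.1, p.2))
  have key : ∀ y : ℝ, ∫ x in y..1, f.dx (1 - x) y = f.val (1 - y) y - f.val 0 y := by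
    intro y
    rw [intervalIntegral.integral_comp_sub_left (fun x => f.dx x y) 1, integral_dx]
    simp
  have hanti : f.antidiag = ∫ y in (0 : ℝ)..1, f.val (1 - y) y := by
    have := intervalIntegral.integral_comp_sub_left (a := 0) (b := 1)
      (fun x => f.val x (1 - x)) 1
    simp only [sub_sub_cancel, sub_self, sub_zero] at this
    rw [this, antidiag]
  rw [lowerLeftAvg_eq_lowerRightAvg, lowerRightAvg, integral_triangle_swap hc, hanti]
  simp only [key, left]
  rw [← intervalIntegral.integral_sub
    (f.intervalIntegrable_path (by fun_prop : Continuous fun x : ℝ => 1 - x) continuous_id')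
    (f.intervalIntegrable_path continuous_const continuous_id')]

end PlaneFun

section averages

variable {g h : ℝ → ℝ → ℝ}

lemma squareAvg_add (hg : Continuous fun p : ℝ × ℝ => g p.1 p.2)
    (hh : Continuous fun p : ℝ × ℝ => h p.1 p.2) :
    squareAvg (fun x y => g x y + h x y) = squareAvg g + squareAvg h := by
  unfold squareAvg
  rw [← intervalIntegral.integral_add
    ((continuous_integral_zero_to hg continuous_const continuous_const).intervalIntegrable _ _)
    ((continuous_integral_zero_to hh continuous_const continuous_const).intervalIntegrable _ _)]
  congr 1
  funext x
  exact intervalIntegral.integral_add ((continuous_section hg x).intervalIntegrable _ _)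
    ((continuous_section hh x).intervalIntegrable _ _)

lemma squareAvg_sub (hg : Continuous fun p : ℝ × ℝ => g p.1 p.2)
    (hh : Continuous fun p : ℝ × ℝ => h p.1 p.2) :
    squareAvg (fun x y => g x y - h x y) = squareAvg g - squareAvg h := by
  have := squareAvg_add (g := fun x y => g x y - h x y) (h := h) (hg.sub hh) hh
  simp only [sub_add_cancel] at this
  linarith

lemma lowerRightAvg_add (hg : Continuous fun p : ℝ × ℝ => g p.1 p.2)
    (hh : Continuous fun p : ℝ × ℝ => h p.1 p.2) :
    lowerRightAvg (fun x y => g x y + h x y) = lowerRightAvg g + lowerRightAvg h := by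
  unfold lowerRightAvg
  rw [← mul_add, ← intervalIntegral.integral_add
    ((continuous_integral_zero_to hg continuous_const continuous_id').intervalIntegrable _ _)
    ((continuous_integral_zero_to hh continuous_const continuous_id').intervalIntegrable _ _)]
  congr 2
  funext x
  exact intervalIntegral.integral_add ((continuous_section hg x).intervalIntegrable _ _)
    ((continuous_section hh x).intervalIntegrable _ _)

lemma continuous_reflect (hg : Continuous fun p : ℝ × ℝ => g p.1 p.2) :
    Continuous fun p : ℝ × ℝ => g (1 - p.1) p.2 :=
  hg.comp (by fun_prop : Continuous fun p : ℝ × ℝ => (1 - p.1, p.2))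

lemma lowerLeftAvg_add (hg : Continuous fun p : ℝ × ℝ => g p.1 p.2)
    (hh : Continuous fun p : ℝ × ℝ => h p.1 p.2) :
    lowerLeftAvg (fun x y => g x y + h x y) = lowerLeftAvg g + lowerLeftAvg h := by
  simp only [lowerLeftAvg_eq_lowerRightAvg]
  exact lowerRightAvg_add (continuous_reflect hg) (continuous_reflect hh)

lemma squareAvg_mono (hg : Continuous fun p : ℝ × ℝ => g p.1 p.2)
    (hh : Continuous fun p : ℝ × ℝ => h p.1 p.2)
    (hgh : ∀ x ∈ Set.Icc (0 : ℝ) 1, ∀ y ∈ Set.Icc (0 : ℝ) 1, g x y ≤ h x y) :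
    squareAvg g ≤ squareAvg h :=
  intervalIntegral.integral_mono_on zero_le_one
    ((continuous_integral_zero_to hg continuous_const continuous_const).intervalIntegrable _ _)
    ((continuous_integral_zero_to hh continuous_const continuous_const).intervalIntegrable _ _)
    fun x hx => intervalIntegral.integral_mono_on zero_le_one
      ((continuous_section hg x).intervalIntegrable _ _)
      ((continuous_section hh x).intervalIntegrable _ _) fun y hy => hgh x hx y hy

lemma squareAvg_const (c : ℝ) : squareAvg (fun _ _ => c) = c := by simp [squareAvg]

lemma abs_squareAvg_le (hg : Continuous fun p : ℝ × ℝ => g p.1 p.2) :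
    |squareAvg g| ≤ squareAvg fun x y => |g x y| := by
  rw [abs_le]
  have h0 := squareAvg_sub (g := fun _ _ => 0) (h := fun x y => |g x y|) continuous_const hg.abs
  simp only [squareAvg_const, zero_sub] at h0
  exact ⟨h0 ▸ squareAvg_mono hg.abs.neg hg fun x _ y _ => neg_abs_le _,
    squareAvg_mono hg hg.abs fun x _ y _ => le_abs_self _⟩

lemma abs_lowerRightAvg_le (hg : Continuous fun p : ℝ × ℝ => g p.1 p.2) :
    |lowerRightAvg g| ≤ 2 * squareAvg fun x y => |g x y| := by
  unfold lowerRightAvg squareAvg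
  rw [abs_mul, abs_two]
  gcongr
  refine (intervalIntegral.abs_integral_le_integral_abs zero_le_one).trans ?_
  refine intervalIntegral.integral_mono_on zero_le_one
    ((continuous_integral_zero_to hg continuous_const continuous_id').abs.intervalIntegrable _ _)
    ((continuous_integral_zero_to hg.abs continuous_const
      continuous_const).intervalIntegrable _ _) fun x hx => ?_
  refine (intervalIntegral.abs_integral_le_integral_abs hx.1).trans ?_
  exact intervalIntegral.integral_mono_interval le_rfl hx.1 hx.2
    (Filter.Eventually.of_forall fun y => abs_nonneg _)
    ((continuous_section hg x).abs.intervalIntegrable _ _)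

lemma abs_lowerLeftAvg_le (hg : Continuous fun p : ℝ × ℝ => g p.1 p.2) :
    |lowerLeftAvg g| ≤ 2 * squareAvg fun x y => |g x y| := by
  rw [lowerLeftAvg_eq_lowerRightAvg, ← squareAvg_reflect fun x y => |g x y|]
  exact abs_lowerRightAvg_le (continuous_reflect hg)

end averages

/-- Squared deviation of the averages of `g` over the square and its diagonal halves from `μ`. -/
noncomputable def deviation (g : ℝ → ℝ → ℝ) (μ : ℝ) : ℝ :=
  (squareAvg g - μ) ^ 2 + (lowerRightAvg g - squareAvg g) ^ 2 + (lowerLeftAvg g - squareAvg g) ^ 2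

/-- A quadratic form in the averages of `g` that grows under dyadic subdivision. -/
noncomputable def averageEnergy (g : ℝ → ℝ → ℝ) : ℝ :=
  7 * squareAvg g ^ 2 +
    4 * ((lowerRightAvg g - squareAvg g) ^ 2 + (lowerLeftAvg g - squareAvg g) ^ 2)

lemma deviation_nonneg (g : ℝ → ℝ → ℝ) (μ : ℝ) : 0 ≤ deviation g μ := by
  unfold deviation; positivity

lemma deviation_le (g : ℝ → ℝ → ℝ) (μ ν : ℝ) :
    deviation g μ ≤ 2 * deviation g ν + 2 * (ν - μ) ^ 2 := by
  unfold deviation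
  nlinarith [sq_nonneg (squareAvg g - ν - (ν - μ)), sq_nonneg (lowerRightAvg g - squareAvg g),
    sq_nonneg (lowerLeftAvg g - squareAvg g)]

lemma weighted_sq_le (x y s t : ℝ) :
    (x + y + s + t) ^ 2 ≤ 3 * (x ^ 2 + y ^ 2) + 6 * (s ^ 2 + t ^ 2) := by
  nlinarith [sq_nonneg (3 * x - (x + y + s + t)), sq_nonneg (3 * y - (x + y + s + t)),
    sq_nonneg (6 * s - (x + y + s + t)), sq_nonneg (6 * t - (x + y + s + t))]

lemma averageEnergy_add_deviation_le {g : ℝ → ℝ → ℝ}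
    (hg : Continuous fun p : ℝ × ℝ => g p.1 p.2) :
    averageEnergy g + (deviation (dyadicRestrict g 0 0) (squareAvg g) +
        deviation (dyadicRestrict g 1 0) (squareAvg g) +
        deviation (dyadicRestrict g 0 1) (squareAvg g) +
        deviation (dyadicRestrict g 1 1) (squareAvg g)) / 4 ≤
      (averageEnergy (dyadicRestrict g 0 0) + averageEnergy (dyadicRestrict g 1 0) +
        averageEnergy (dyadicRestrict g 0 1) + averageEnergy (dyadicRestrict g 1 1)) / 4 := by
  have h1 := squareAvg_eq_dyadic hg
  have h2 := lowerRightAvg_eq_dyadic hg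
  have h3 := lowerLeftAvg_eq_dyadic hg
  unfold averageEnergy deviation
  set m := squareAvg g
  set m00 := squareAvg (dyadicRestrict g 0 0)
  set m10 := squareAvg (dyadicRestrict g 1 0)
  set m01 := squareAvg (dyadicRestrict g 0 1)
  set m11 := squareAvg (dyadicRestrict g 1 1)
  have ea : lowerRightAvg g - m = ((lowerRightAvg (dyadicRestrict g 0 0) - m00) +
      (lowerRightAvg (dyadicRestrict g 1 1) - m11) + (m10 - m) + (m - m01)) / 4 := by
    rw [h2]; linarith
  have eb : lowerLeftAvg g - m = ((lowerLeftAvg (dyadicRestrict g 1 0) - m10) +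
      (lowerLeftAvg (dyadicRestrict g 0 1) - m01) + (m00 - m) + (m - m11)) / 4 := by
    rw [h3]; linarith
  have qa := weighted_sq_le (lowerRightAvg (dyadicRestrict g 0 0) - m00)
    (lowerRightAvg (dyadicRestrict g 1 1) - m11) (m10 - m) (m - m01)
  have qb := weighted_sq_le (lowerLeftAvg (dyadicRestrict g 1 0) - m10)
    (lowerLeftAvg (dyadicRestrict g 0 1) - m01) (m00 - m) (m - m11)
  rw [ea, eb]
  have hvar : m00 ^ 2 + m10 ^ 2 + m01 ^ 2 + m11 ^ 2 = 4 * m ^ 2 + ((m00 - m) ^ 2 + (m10 - m) ^ 2 +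
      (m01 - m) ^ 2 + (m11 - m) ^ 2) := by
    rw [h1]; ring
  have s1 := sq_nonneg (lowerRightAvg (dyadicRestrict g 1 0) - m10)
  have s2 := sq_nonneg (lowerRightAvg (dyadicRestrict g 0 1) - m01)
  have s3 := sq_nonneg (lowerLeftAvg (dyadicRestrict g 0 0) - m00)
  have s4 := sq_nonneg (lowerLeftAvg (dyadicRestrict g 1 1) - m11)
  have r1 : (m - m01) ^ 2 = (m01 - m) ^ 2 := by ring
  have r2 : (m - m11) ^ 2 = (m11 - m) ^ 2 := by ring
  rw [r1] at qa
  rw [r2] at qb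
  rw [div_pow, div_pow]
  linarith

lemma averageEnergy_le {g : ℝ → ℝ → ℝ} (hg : Continuous fun p : ℝ × ℝ => g p.1 p.2) :
    averageEnergy g ≤ 79 * (squareAvg fun x y => |g x y|) ^ 2 := by
  have h1 := abs_le.1 (abs_squareAvg_le hg)
  have h2 := abs_le.1 (abs_lowerRightAvg_le hg)
  have h3 := abs_le.1 (abs_lowerLeftAvg_le hg)
  set s := squareAvg fun x y => |g x y|
  have b1 : squareAvg g ^ 2 ≤ s ^ 2 := sq_le_sq' h1.1 h1.2
  have b2 : (lowerRightAvg g - squareAvg g) ^ 2 ≤ (3 * s) ^ 2 :=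
    sq_le_sq' (by linarith) (by linarith)
  have b3 : (lowerLeftAvg g - squareAvg g) ^ 2 ≤ (3 * s) ^ 2 :=
    sq_le_sq' (by linarith) (by linarith)
  unfold averageEnergy
  linarith

lemma averageEnergy_nonneg (g : ℝ → ℝ → ℝ) : 0 ≤ averageEnergy g := by
  unfold averageEnergy; positivity

/-- A continuously differentiable map `(u, v)` of the plane. -/
structure PlaneMap where
  u : PlaneFun
  v : PlaneFun

namespace PlaneMap

/-- Restriction of a map to a dyadic subsquare, rescaled to the unit square. -/
noncomputable def child (J : PlaneMap) (a b : ℝ) : PlaneMap := ⟨J.u.child a b, J.v.child a b⟩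

/-- The sum of the two off-diagonal partial derivatives. -/
def shear (J : PlaneMap) : ℝ → ℝ → ℝ := fun x y => J.u.dy x y + J.v.dx x y

/-- The difference of the two off-diagonal partial derivatives. -/
def vort (J : PlaneMap) : ℝ → ℝ → ℝ := fun x y => J.u.dy x y - J.v.dx x y

/-- Average of the vorticity over the unit square. -/
noncomputable def vortAvg (J : PlaneMap) : ℝ := squareAvg J.vort

/-- Deviation of the averages of the strain of `J` from those of `K`. -/
noncomputable def strainDev (J K : PlaneMap) : ℝ :=
  deviation J.u.dx (squareAvg K.u.dx) + deviation J.v.dy (squareAvg K.v.dy) +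
    deviation J.shear (squareAvg K.shear)

/-- Average of a functional over the four dyadic children. -/
noncomputable def childAvg (F : PlaneMap → ℝ) (J : PlaneMap) : ℝ :=
  (F (J.child 0 0) + F (J.child 1 0) + F (J.child 0 1) + F (J.child 1 1)) / 4

/-- Total `L¹` norm of the strain over the unit square. -/
noncomputable def strainNorm (J : PlaneMap) : ℝ :=
  (squareAvg fun x y => |J.u.dx x y|) + (squareAvg fun x y => |J.v.dy x y|) +
    squareAvg fun x y => |J.shear x y|

/-- Potential decreasing on average under dyadic subdivision. -/
noncomputable def potential (J : PlaneMap) : ℝ :=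
  320 * J.strainNorm - (averageEnergy J.u.dx + averageEnergy J.v.dy + averageEnergy J.shear)

/-- Four maps on squares forming a two by two block (`A` lower left, `B` upper right, `C` upper
left, `D` lower right), with matching traces. -/
structure IsBlock (A B C D : PlaneFun) : Prop where
  bottom : A.right = D.left
  left : A.top = C.bottom
  top : B.left = C.right
  right : B.bottom = D.top

variable (J K : PlaneMap)

lemma continuous_shear : Continuous fun p : ℝ × ℝ => J.shear p.1 p.2 := J.u.cont_dy.add J.v.cont_dx

lemma continuous_vort : Continuous fun p : ℝ × ℝ => J.vort p.1 p.2 := J.u.cont_dy.sub J.v.cont_dx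

lemma vortAvg_eq : J.vortAvg = J.u.top - J.u.bottom - (J.v.right - J.v.left) := by
  rw [← J.u.squareAvg_dy, ← J.v.squareAvg_dx]
  exact squareAvg_sub J.u.cont_dy J.v.cont_dx

lemma squareAvg_shear : squareAvg J.shear = J.u.top - J.u.bottom + (J.v.right - J.v.left) := by
  rw [← J.u.squareAvg_dy, ← J.v.squareAvg_dx]
  exact squareAvg_add J.u.cont_dy J.v.cont_dx

lemma lowerRightAvg_shear :
    lowerRightAvg J.shear = 2 * (J.u.diag - J.u.bottom) + 2 * (J.v.right - J.v.diag) := by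
  rw [← J.u.lowerRightAvg_dy, ← J.v.lowerRightAvg_dx]
  exact lowerRightAvg_add J.u.cont_dy J.v.cont_dx

lemma lowerLeftAvg_shear :
    lowerLeftAvg J.shear = 2 * (J.u.antidiag - J.u.bottom) + 2 * (J.v.antidiag - J.v.left) := by
  rw [← J.u.lowerLeftAvg_dy, ← J.v.lowerLeftAvg_dx]
  exact lowerLeftAvg_add J.u.cont_dy J.v.cont_dx

lemma add_six_sq_le (a b c d e f : ℝ) :
    (a + b + c + d + e + f) ^ 2 ≤ 6 * (a ^ 2 + b ^ 2 + c ^ 2 + d ^ 2 + e ^ 2 + f ^ 2) := by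
  have := sq_sum_le_card_mul_sum_sq (s := (Finset.univ : Finset (Fin 6))) (f := ![a, b, c, d, e, f])
  simp [Fin.sum_univ_succ] at this
  exact le_trans (le_of_eq (by ring)) (this.trans (le_of_eq (by ring)))

lemma add_four_sq_le (a b c d : ℝ) :
    (a + b + c + d) ^ 2 ≤ 4 * (a ^ 2 + b ^ 2 + c ^ 2 + d ^ 2) := by
  have := add_six_sq_le a b c d ((a + b + c + d) / 4) ((a + b + c + d) / 4)
  nlinarith

lemma block_sq_le {A B C D : ℝ} {a b c d : ℝ} (hA : A ^ 2 ≤ 6 * a) (hB : B ^ 2 ≤ 6 * b)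
    (hC : C ^ 2 ≤ 6 * c) (hD : D ^ 2 ≤ 6 * d) : (A + B + C + D) ^ 2 ≤ 24 * (a + b + c + d) := by
  have := add_four_sq_le A B C D
  linarith

/-- Differences of vorticity averages across the diagonal of a block are controlled by strain. -/
lemma sq_vortAvg_sub_le_diag {A B C D : PlaneMap} (hu : IsBlock A.u B.u C.u D.u)
    (hv : IsBlock A.v B.v C.v D.v) (K : PlaneMap) :
    (A.vortAvg - B.vortAvg) ^ 2 ≤
      24 * (A.strainDev K + B.strainDev K + C.strainDev K + D.strainDev K) := by
  set μ₁ := squareAvg K.u.dx with hμ₁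
  set μ₂ := squareAvg K.v.dy with hμ₂
  set μ₃ := squareAvg K.shear with hμ₃
  have key : A.vortAvg - B.vortAvg =
      ((squareAvg A.u.dx - μ₁) + (lowerRightAvg A.u.dx - squareAvg A.u.dx) +
        -(squareAvg A.v.dy - μ₂) + (lowerRightAvg A.v.dy - squareAvg A.v.dy) +
        (lowerRightAvg A.shear - squareAvg A.shear) + 0) +
      (-(squareAvg B.u.dx - μ₁) + (lowerRightAvg B.u.dx - squareAvg B.u.dx) +
        (squareAvg B.v.dy - μ₂) + (lowerRightAvg B.v.dy - squareAvg B.v.dy) +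
        (lowerRightAvg B.shear - squareAvg B.shear) + 0) +
      (-(squareAvg C.u.dx - μ₁) + -(lowerRightAvg C.u.dx - squareAvg C.u.dx) +
        -(squareAvg C.v.dy - μ₂) + -(lowerRightAvg C.v.dy - squareAvg C.v.dy) +
        -(squareAvg C.shear - μ₃) + -(lowerRightAvg C.shear - squareAvg C.shear)) +
      ((squareAvg D.u.dx - μ₁) + -(lowerRightAvg D.u.dx - squareAvg D.u.dx) +
        (squareAvg D.v.dy - μ₂) + -(lowerRightAvg D.v.dy - squareAvg D.v.dy) +
        (squareAvg D.shear - μ₃) + -(lowerRightAvg D.shear - squareAvg D.shear)) := by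
    simp only [vortAvg_eq, squareAvg_shear, lowerRightAvg_shear, PlaneFun.squareAvg_dx,
      PlaneFun.squareAvg_dy, PlaneFun.lowerRightAvg_dx, PlaneFun.lowerRightAvg_dy]
    linarith [hu.bottom, hu.left, hu.top, hu.right, hv.bottom, hv.left, hv.top, hv.right]
  rw [key]
  apply block_sq_le <;> refine (add_six_sq_le _ _ _ _ _ _).trans ?_ <;>
    simp only [strainDev, deviation, ← hμ₁, ← hμ₂, ← hμ₃, neg_sq] <;>
    linarith [sq_nonneg (squareAvg A.shear - μ₃), sq_nonneg (squareAvg B.shear - μ₃),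
      sq_nonneg (lowerLeftAvg A.u.dx - squareAvg A.u.dx),
      sq_nonneg (lowerLeftAvg A.v.dy - squareAvg A.v.dy),
      sq_nonneg (lowerLeftAvg A.shear - squareAvg A.shear),
      sq_nonneg (lowerLeftAvg B.u.dx - squareAvg B.u.dx),
      sq_nonneg (lowerLeftAvg B.v.dy - squareAvg B.v.dy),
      sq_nonneg (lowerLeftAvg B.shear - squareAvg B.shear),
      sq_nonneg (lowerLeftAvg C.u.dx - squareAvg C.u.dx),
      sq_nonneg (lowerLeftAvg C.v.dy - squareAvg C.v.dy),
      sq_nonneg (lowerLeftAvg C.shear - squareAvg C.shear),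
      sq_nonneg (lowerLeftAvg D.u.dx - squareAvg D.u.dx),
      sq_nonneg (lowerLeftAvg D.v.dy - squareAvg D.v.dy),
      sq_nonneg (lowerLeftAvg D.shear - squareAvg D.shear)]

/-- Differences of vorticity averages across the antidiagonal of a block are controlled by
strain. -/
lemma sq_vortAvg_sub_le_antidiag {A B C D : PlaneMap} (hu : IsBlock A.u B.u C.u D.u)
    (hv : IsBlock A.v B.v C.v D.v) (K : PlaneMap) :
    (C.vortAvg - D.vortAvg) ^ 2 ≤
      24 * (A.strainDev K + B.strainDev K + C.strainDev K + D.strainDev K) := by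
  set μ₁ := squareAvg K.u.dx with hμ₁
  set μ₂ := squareAvg K.v.dy with hμ₂
  set μ₃ := squareAvg K.shear with hμ₃
  have key : C.vortAvg - D.vortAvg =
      ((squareAvg A.u.dx - μ₁) + -(lowerLeftAvg A.u.dx - squareAvg A.u.dx) +
        (squareAvg A.v.dy - μ₂) + -(lowerLeftAvg A.v.dy - squareAvg A.v.dy) +
        -(squareAvg A.shear - μ₃) + (lowerLeftAvg A.shear - squareAvg A.shear)) +
      (-(squareAvg B.u.dx - μ₁) + -(lowerLeftAvg B.u.dx - squareAvg B.u.dx) +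
        -(squareAvg B.v.dy - μ₂) + -(lowerLeftAvg B.v.dy - squareAvg B.v.dy) +
        (squareAvg B.shear - μ₃) + (lowerLeftAvg B.shear - squareAvg B.shear)) +
      (-(squareAvg C.u.dx - μ₁) + (lowerLeftAvg C.u.dx - squareAvg C.u.dx) +
        (squareAvg C.v.dy - μ₂) + (lowerLeftAvg C.v.dy - squareAvg C.v.dy) +
        -(lowerLeftAvg C.shear - squareAvg C.shear) + 0) +
      ((squareAvg D.u.dx - μ₁) + (lowerLeftAvg D.u.dx - squareAvg D.u.dx) +
        -(squareAvg D.v.dy - μ₂) + (lowerLeftAvg D.v.dy - squareAvg D.v.dy) +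
        -(lowerLeftAvg D.shear - squareAvg D.shear) + 0) := by
    simp only [vortAvg_eq, squareAvg_shear, lowerLeftAvg_shear, PlaneFun.squareAvg_dx,
      PlaneFun.squareAvg_dy, PlaneFun.lowerLeftAvg_dx, PlaneFun.lowerLeftAvg_dy]
    linarith [hu.bottom, hu.left, hu.top, hu.right, hv.bottom, hv.left, hv.top, hv.right]
  rw [key]
  apply block_sq_le <;> refine (add_six_sq_le _ _ _ _ _ _).trans ?_ <;>
    simp only [strainDev, deviation, ← hμ₁, ← hμ₂, ← hμ₃, neg_sq] <;>
    linarith [sq_nonneg (squareAvg C.shear - μ₃), sq_nonneg (squareAvg D.shear - μ₃),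
      sq_nonneg (lowerRightAvg A.u.dx - squareAvg A.u.dx),
      sq_nonneg (lowerRightAvg A.v.dy - squareAvg A.v.dy),
      sq_nonneg (lowerRightAvg A.shear - squareAvg A.shear),
      sq_nonneg (lowerRightAvg B.u.dx - squareAvg B.u.dx),
      sq_nonneg (lowerRightAvg B.v.dy - squareAvg B.v.dy),
      sq_nonneg (lowerRightAvg B.shear - squareAvg B.shear),
      sq_nonneg (lowerRightAvg C.u.dx - squareAvg C.u.dx),
      sq_nonneg (lowerRightAvg C.v.dy - squareAvg C.v.dy),
      sq_nonneg (lowerRightAvg C.shear - squareAvg C.shear),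
      sq_nonneg (lowerRightAvg D.u.dx - squareAvg D.u.dx),
      sq_nonneg (lowerRightAvg D.v.dy - squareAvg D.v.dy),
      sq_nonneg (lowerRightAvg D.shear - squareAvg D.shear)]

/-- Average deviation of the strain of the children of `J` from that of `J`. -/
noncomputable def childDev (J : PlaneMap) : ℝ := childAvg (fun K => K.strainDev J) J

lemma isBlock_child (f : PlaneFun) :
    IsBlock (f.child 0 0) (f.child 1 1) (f.child 0 1) (f.child 1 0) := by
  constructor <;>
    simp [PlaneFun.right, PlaneFun.left, PlaneFun.top, PlaneFun.bottom, PlaneFun.child]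

lemma isBlock_left (f : PlaneFun) :
    IsBlock ((f.child 0 0).child 0 1) ((f.child 0 1).child 1 0) ((f.child 0 1).child 0 0)
      ((f.child 0 0).child 1 1) := by
  constructor <;>
    simp [PlaneFun.right, PlaneFun.left, PlaneFun.top, PlaneFun.bottom, PlaneFun.child]

lemma isBlock_bottom (f : PlaneFun) :
    IsBlock ((f.child 0 0).child 1 0) ((f.child 1 0).child 0 1) ((f.child 0 0).child 1 1)
      ((f.child 1 0).child 0 0) := by
  constructor <;>
    simp [PlaneFun.right, PlaneFun.left, PlaneFun.top, PlaneFun.bottom, PlaneFun.child]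

lemma isBlock_top (f : PlaneFun) :
    IsBlock ((f.child 0 1).child 1 0) ((f.child 1 1).child 0 1) ((f.child 0 1).child 1 1)
      ((f.child 1 1).child 0 0) := by
  constructor <;>
    simp [PlaneFun.right, PlaneFun.left, PlaneFun.top, PlaneFun.bottom, PlaneFun.child]

lemma isBlock_right (f : PlaneFun) :
    IsBlock ((f.child 1 0).child 0 1) ((f.child 1 1).child 1 0) ((f.child 1 1).child 0 0)
      ((f.child 1 0).child 1 1) := by
  constructor <;>
    simp [PlaneFun.right, PlaneFun.left, PlaneFun.top, PlaneFun.bottom, PlaneFun.child]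

lemma strainDev_nonneg (J K : PlaneMap) : 0 ≤ J.strainDev K :=
  add_nonneg (add_nonneg (deviation_nonneg _ _) (deviation_nonneg _ _)) (deviation_nonneg _ _)

lemma strainDev_le (J K L : PlaneMap) :
    J.strainDev L ≤ 2 * J.strainDev K + 2 * K.strainDev L := by
  have h1 := deviation_le J.u.dx (squareAvg L.u.dx) (squareAvg K.u.dx)
  have h2 := deviation_le J.v.dy (squareAvg L.v.dy) (squareAvg K.v.dy)
  have h3 := deviation_le J.shear (squareAvg L.shear) (squareAvg K.shear)
  have h : ∀ (g : ℝ → ℝ → ℝ) (μ : ℝ), (squareAvg g - μ) ^ 2 ≤ deviation g μ := fun g μ => by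
    unfold deviation
    linarith [sq_nonneg (lowerRightAvg g - squareAvg g), sq_nonneg (lowerLeftAvg g - squareAvg g)]
  unfold strainDev
  linarith [h K.u.dx (squareAvg L.u.dx), h K.v.dy (squareAvg L.v.dy),
    h K.shear (squareAvg L.shear)]

lemma childDev_nonneg (J : PlaneMap) : 0 ≤ J.childDev := by
  unfold childDev childAvg
  have := fun a b => (J.child a b).strainDev_nonneg J
  linarith [this 0 0, this 0 1, this 1 0, this 1 1]

lemma grandchild_strainDev_le (J : PlaneMap) :
    childAvg (childAvg fun K => K.strainDev J) J ≤ 2 * childAvg childDev J + 2 * J.childDev := by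
  have h : ∀ a b, childAvg (fun K => K.strainDev J) (J.child a b) ≤
      2 * (J.child a b).childDev + 2 * (J.child a b).strainDev J := by
    intro a b
    have := fun c d => strainDev_le ((J.child a b).child c d) (J.child a b) J
    simp only [childDev, childAvg]
    linarith [this 0 0, this 0 1, this 1 0, this 1 1]
  simp only [childAvg, childDev] at h ⊢
  linarith [h 0 0, h 0 1, h 1 0, h 1 1]

lemma vortAvg_eq_childAvg (J : PlaneMap) : J.vortAvg = childAvg vortAvg J := by
  unfold vortAvg childAvg
  exact squareAvg_eq_dyadic J.continuous_vort

lemma add_twelve_sq_le {M a b c d e f u v w x y z : ℝ} (ha : a ^ 2 ≤ M) (hb : b ^ 2 ≤ M)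
    (hc : c ^ 2 ≤ M) (hd : d ^ 2 ≤ M) (he : e ^ 2 ≤ M) (hf : f ^ 2 ≤ M) (hu : u ^ 2 ≤ M)
    (hv : v ^ 2 ≤ M) (hw : w ^ 2 ≤ M) (hx : x ^ 2 ≤ M) (hy : y ^ 2 ≤ M)
    (hz : z ^ 2 ≤ M) :
    ((a + b + c + d + e + f) + (u + v + w + x + y + z)) ^ 2 ≤ 144 * M := by
  have h := add_six_sq_le a b c d e f
  have k := add_six_sq_le u v w x y z
  nlinarith [sq_nonneg ((a + b + c + d + e + f) - (u + v + w + x + y + z))]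

/-- The checkerboard difference of vorticity averages over the children is controlled by strain. -/
lemma sq_checkerboard_le (J : PlaneMap) :
    ((J.child 0 0).vortAvg + (J.child 1 1).vortAvg - (J.child 0 1).vortAvg -
      (J.child 1 0).vortAvg) ^ 2 ≤ 3456 * childAvg (childAvg fun K => K.strainDev J) J := by
  have nn := fun a b c d => ((J.child a b).child c d).strainDev_nonneg J
  obtain ⟨T, hT⟩ : ∃ T, T = childAvg (childAvg fun K => K.strainDev J) J := ⟨_, rfl⟩
  rw [← hT]
  simp only [childAvg] at hT
  have n0000 := nn 0 0 0 0
  have n0001 := nn 0 0 0 1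
  have n0010 := nn 0 0 1 0
  have n0011 := nn 0 0 1 1
  have n0100 := nn 0 1 0 0
  have n0101 := nn 0 1 0 1
  have n0110 := nn 0 1 1 0
  have n0111 := nn 0 1 1 1
  have n1000 := nn 1 0 0 0
  have n1001 := nn 1 0 0 1
  have n1010 := nn 1 0 1 0
  have n1011 := nn 1 0 1 1
  have n1100 := nn 1 1 0 0
  have n1101 := nn 1 1 0 1
  have n1110 := nn 1 1 1 0
  have n1111 := nn 1 1 1 1
  have h0011 : (((J.child 0 0).child 0 0).vortAvg - ((J.child 0 0).child 1 1).vortAvg) ^ 2 ≤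
      384 * T :=
    (sq_vortAvg_sub_le_diag (A := (J.child 0 0).child 0 0) (B := (J.child 0 0).child 1 1)
      (C := (J.child 0 0).child 0 1) (D := (J.child 0 0).child 1 0)
      (isBlock_child _) (isBlock_child _) J).trans (by linarith)
  have h2233 : (((J.child 1 1).child 1 1).vortAvg - ((J.child 1 1).child 0 0).vortAvg) ^ 2 ≤
      384 * T :=
    (sub_sq_comm _ _).trans_le ((sq_vortAvg_sub_le_diag
      (A := (J.child 1 1).child 0 0) (B := (J.child 1 1).child 1 1)
      (C := (J.child 1 1).child 0 1) (D := (J.child 1 1).child 1 0)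
      (isBlock_child _) (isBlock_child _) J).trans (by linarith))
  have h1102 : (((J.child 0 0).child 1 1).vortAvg - ((J.child 0 1).child 0 0).vortAvg) ^ 2 ≤
      384 * T :=
    (sub_sq_comm _ _).trans_le ((sq_vortAvg_sub_le_antidiag
      (A := (J.child 0 0).child 0 1) (B := (J.child 0 1).child 1 0)
      (C := (J.child 0 1).child 0 0) (D := (J.child 0 0).child 1 1)
      (isBlock_left _) (isBlock_left _) J).trans (by linarith))
  have h1120 : (((J.child 0 0).child 1 1).vortAvg - ((J.child 1 0).child 0 0).vortAvg) ^ 2 ≤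
      384 * T :=
    (sq_vortAvg_sub_le_antidiag (A := (J.child 0 0).child 1 0) (B := (J.child 1 0).child 0 1)
      (C := (J.child 0 0).child 1 1) (D := (J.child 1 0).child 0 0)
      (isBlock_bottom _) (isBlock_bottom _) J).trans (by linarith)
  have h2213 : (((J.child 1 1).child 0 0).vortAvg - ((J.child 0 1).child 1 1).vortAvg) ^ 2 ≤
      384 * T :=
    (sub_sq_comm _ _).trans_le ((sq_vortAvg_sub_le_antidiag
      (A := (J.child 0 1).child 1 0) (B := (J.child 1 1).child 0 1)
      (C := (J.child 0 1).child 1 1) (D := (J.child 1 1).child 0 0)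
      (isBlock_top _) (isBlock_top _) J).trans (by linarith))
  have h2231 : (((J.child 1 1).child 0 0).vortAvg - ((J.child 1 0).child 1 1).vortAvg) ^ 2 ≤
      384 * T :=
    (sq_vortAvg_sub_le_antidiag (A := (J.child 1 0).child 0 1) (B := (J.child 1 1).child 1 0)
      (C := (J.child 1 1).child 0 0) (D := (J.child 1 0).child 1 1)
      (isBlock_right _) (isBlock_right _) J).trans (by linarith)
  have h0112 : (((J.child 0 0).child 0 1).vortAvg - ((J.child 0 1).child 1 0).vortAvg) ^ 2 ≤
      384 * T :=
    (sq_vortAvg_sub_le_diag (A := (J.child 0 0).child 0 1) (B := (J.child 0 1).child 1 0)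
      (C := (J.child 0 1).child 0 0) (D := (J.child 0 0).child 1 1)
      (isBlock_left _) (isBlock_left _) J).trans (by linarith)
  have h2312 : (((J.child 1 1).child 0 1).vortAvg - ((J.child 0 1).child 1 0).vortAvg) ^ 2 ≤
      384 * T :=
    (sub_sq_comm _ _).trans_le ((sq_vortAvg_sub_le_diag
      (A := (J.child 0 1).child 1 0) (B := (J.child 1 1).child 0 1)
      (C := (J.child 0 1).child 1 1) (D := (J.child 1 1).child 0 0)
      (isBlock_top _) (isBlock_top _) J).trans (by linarith))
  have h1203 : (((J.child 0 1).child 1 0).vortAvg - ((J.child 0 1).child 0 1).vortAvg) ^ 2 ≤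
      384 * T :=
    (sub_sq_comm _ _).trans_le ((sq_vortAvg_sub_le_antidiag
      (A := (J.child 0 1).child 0 0) (B := (J.child 0 1).child 1 1)
      (C := (J.child 0 1).child 0 1) (D := (J.child 0 1).child 1 0)
      (isBlock_child _) (isBlock_child _) J).trans (by linarith))
  have h1021 : (((J.child 0 0).child 1 0).vortAvg - ((J.child 1 0).child 0 1).vortAvg) ^ 2 ≤
      384 * T :=
    (sq_vortAvg_sub_le_diag (A := (J.child 0 0).child 1 0) (B := (J.child 1 0).child 0 1)
      (C := (J.child 0 0).child 1 1) (D := (J.child 1 0).child 0 0)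
      (isBlock_bottom _) (isBlock_bottom _) J).trans (by linarith)
  have h3221 : (((J.child 1 1).child 1 0).vortAvg - ((J.child 1 0).child 0 1).vortAvg) ^ 2 ≤
      384 * T :=
    (sub_sq_comm _ _).trans_le ((sq_vortAvg_sub_le_diag
      (A := (J.child 1 0).child 0 1) (B := (J.child 1 1).child 1 0)
      (C := (J.child 1 1).child 0 0) (D := (J.child 1 0).child 1 1)
      (isBlock_right _) (isBlock_right _) J).trans (by linarith))
  have h2130 : (((J.child 1 0).child 0 1).vortAvg - ((J.child 1 0).child 1 0).vortAvg) ^ 2 ≤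
      384 * T :=
    (sq_vortAvg_sub_le_antidiag (A := (J.child 1 0).child 0 0) (B := (J.child 1 0).child 1 1)
      (C := (J.child 1 0).child 0 1) (D := (J.child 1 0).child 1 0)
      (isBlock_child _) (isBlock_child _) J).trans (by linarith)
  have key := add_twelve_sq_le h0011 h2233 h1102 h1120 h2213 h2231
    h0112 h2312 h1203 h1021 h3221 h2130
  have e := fun a b => (J.child a b).vortAvg_eq_childAvg
  simp only [childAvg] at e
  rw [e 0 0, e 1 1, e 0 1, e 1 0]
  linarith

/-- Growth of the mean square of vorticity averages under subdivision. -/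
lemma childAvg_sq_vortAvg_le (J : PlaneMap) :
    childAvg (fun K => K.vortAvg ^ 2) J ≤
      J.vortAvg ^ 2 + 456 * (J.childDev + childAvg childDev J) := by
  have p : ((J.child 0 0).vortAvg - (J.child 1 1).vortAvg) ^ 2 ≤ 24 * (4 * J.childDev) :=
    (sq_vortAvg_sub_le_diag
      (A := J.child 0 0) (B := J.child 1 1) (C := J.child 0 1) (D := J.child 1 0)
      (isBlock_child _) (isBlock_child _) J).trans (by simp only [childDev, childAvg]; linarith)
  have q : ((J.child 0 1).vortAvg - (J.child 1 0).vortAvg) ^ 2 ≤ 24 * (4 * J.childDev) :=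
    (sq_vortAvg_sub_le_antidiag
      (A := J.child 0 0) (B := J.child 1 1) (C := J.child 0 1) (D := J.child 1 0)
      (isBlock_child _) (isBlock_child _) J).trans (by simp only [childDev, childAvg]; linarith)
  have H := J.sq_checkerboard_le
  have e := J.vortAvg_eq_childAvg
  have g := J.grandchild_strainDev_le
  have c : 0 ≤ childAvg childDev J := by
    simp only [childAvg]
    have := fun a b => (J.child a b).childDev_nonneg
    linarith [this 0 0, this 0 1, this 1 0, this 1 1]
  have id : childAvg (fun K => K.vortAvg ^ 2) J = J.vortAvg ^ 2 +
      (((J.child 0 0).vortAvg - (J.child 1 1).vortAvg) ^ 2 / 2 +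
      ((J.child 0 1).vortAvg - (J.child 1 0).vortAvg) ^ 2 / 2 +
      ((J.child 0 0).vortAvg + (J.child 1 1).vortAvg - (J.child 0 1).vortAvg -
      (J.child 1 0).vortAvg) ^ 2 / 4) / 4 := by
    rw [e]; simp only [childAvg]; ring
  rw [id]
  linarith

/-- Potential summed over two consecutive dyadic scales. -/
noncomputable def twoScalePotential (J : PlaneMap) : ℝ := J.potential + childAvg potential J

/-- Average of the truncated square of the vorticity. -/
noncomputable def truncVortAvg (J : PlaneMap) : ℝ := squareAvg fun x y => min (J.vort x y ^ 2) 1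

lemma childAvg_add (F G : PlaneMap → ℝ) (J : PlaneMap) :
    childAvg (fun K => F K + G K) J = childAvg F J + childAvg G J := by
  simp only [childAvg]; ring

lemma childAvg_const_mul (c : ℝ) (F : PlaneMap → ℝ) (J : PlaneMap) :
    childAvg (fun K => c * F K) J = c * childAvg F J := by
  simp only [childAvg]; ring

lemma childAvg_const (c : ℝ) (J : PlaneMap) : childAvg (fun _ => c) J = c := by
  simp only [childAvg]; ring

lemma strainNorm_eq_childAvg (J : PlaneMap) : J.strainNorm = childAvg strainNorm J := by
  have h1 := squareAvg_eq_dyadic (g := fun x y => |J.u.dx x y|) J.u.cont_dx.abs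
  have h2 := squareAvg_eq_dyadic (g := fun x y => |J.v.dy x y|) J.v.cont_dy.abs
  have h3 := squareAvg_eq_dyadic (g := fun x y => |J.shear x y|) J.continuous_shear.abs
  have e : ∀ a b, (J.child a b).strainNorm =
      squareAvg (dyadicRestrict (fun x y => |J.u.dx x y|) a b) +
      squareAvg (dyadicRestrict (fun x y => |J.v.dy x y|) a b) +
      squareAvg (dyadicRestrict (fun x y => |J.shear x y|) a b) := fun _ _ => rfl
  simp only [childAvg, e]
  unfold strainNorm
  linarith

lemma truncVort_continuous (J : PlaneMap) :
    Continuous fun p : ℝ × ℝ => min (J.vort p.1 p.2 ^ 2) 1 :=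
  (J.continuous_vort.pow 2).min continuous_const

lemma truncVortAvg_eq_childAvg (J : PlaneMap) : J.truncVortAvg = childAvg truncVortAvg J :=
  squareAvg_eq_dyadic (g := fun x y => min (J.vort x y ^ 2) 1) J.truncVort_continuous

lemma truncVortAvg_le_one (J : PlaneMap) : J.truncVortAvg ≤ 1 :=
  (squareAvg_mono J.truncVort_continuous continuous_const fun _ _ _ _ => min_le_right _ _).trans_eq
    (squareAvg_const 1)

lemma squareAvg_abs_nonneg {g : ℝ → ℝ → ℝ} (hg : Continuous fun p : ℝ × ℝ => g p.1 p.2) :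
    0 ≤ squareAvg fun x y => |g x y| :=
  (abs_nonneg _).trans (abs_squareAvg_le hg)

lemma strainNorm_nonneg (J : PlaneMap) : 0 ≤ J.strainNorm :=
  add_nonneg (add_nonneg (squareAvg_abs_nonneg J.u.cont_dx) (squareAvg_abs_nonneg J.v.cont_dy))
    (squareAvg_abs_nonneg J.continuous_shear)

lemma potential_le (J : PlaneMap) : J.potential ≤ 320 * J.strainNorm := by
  unfold potential
  linarith [averageEnergy_nonneg J.u.dx, averageEnergy_nonneg J.v.dy, averageEnergy_nonneg J.shear]

lemma le_potential {J : PlaneMap} (h : J.strainNorm ≤ 4) : 4 * J.strainNorm ≤ J.potential := by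
  have h1 := averageEnergy_le J.u.cont_dx
  have h2 := averageEnergy_le J.v.cont_dy
  have h3 := averageEnergy_le J.continuous_shear
  have n1 := squareAvg_abs_nonneg J.u.cont_dx
  have n2 := squareAvg_abs_nonneg J.v.cont_dy
  have n3 := squareAvg_abs_nonneg J.continuous_shear
  unfold potential
  unfold strainNorm at *
  nlinarith [mul_nonneg n1 n2, mul_nonneg n1 n3, mul_nonneg n2 n3,
    mul_nonneg (add_nonneg (add_nonneg n1 n2) n3) (sub_nonneg.2 h)]

lemma childAvg_potential_le (J : PlaneMap) :
    childAvg potential J ≤ J.potential - J.childDev := by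
  have h0 := J.strainNorm_eq_childAvg
  have h1 := averageEnergy_add_deviation_le J.u.cont_dx
  have h2 := averageEnergy_add_deviation_le J.v.cont_dy
  have h3 := averageEnergy_add_deviation_le J.continuous_shear
  have e : ∀ a b, (J.child a b).shear = dyadicRestrict J.shear a b := fun _ _ => rfl
  simp only [childAvg, childDev, potential, strainDev, e] at h0 ⊢
  simp only [child, PlaneFun.child] at h0 ⊢
  linarith

lemma childAvg_twoScalePotential_le (J : PlaneMap) :
    childAvg twoScalePotential J ≤
      J.twoScalePotential - (J.childDev + childAvg childDev J) := by
  have h := J.childAvg_potential_le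
  have h' := fun a b => (J.child a b).childAvg_potential_le
  have hadd : childAvg twoScalePotential J = _ := childAvg_add potential (childAvg potential) J
  rw [hadd, twoScalePotential]
  have : childAvg (childAvg potential) J ≤ childAvg potential J - childAvg childDev J := by
    simp only [childAvg] at h' ⊢
    linarith [h' 0 0, h' 0 1, h' 1 0, h' 1 1]
  linarith

lemma child_strainNorm_le {J : PlaneMap} {a b : ℝ} (ha : a = 0 ∨ a = 1) (hb : b = 0 ∨ b = 1) :
    (J.child a b).strainNorm ≤ 4 * J.strainNorm := by
  have h := J.strainNorm_eq_childAvg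
  have n := fun a b => (J.child a b).strainNorm_nonneg
  simp only [childAvg] at h
  have n1 := n 0 0; have n2 := n 0 1; have n3 := n 1 0; have n4 := n 1 1
  rcases ha with rfl | rfl <;> rcases hb with rfl | rfl <;> linarith

lemma le_twoScalePotential {J : PlaneMap} (h : J.strainNorm ≤ 1) :
    4 * J.strainNorm ≤ J.twoScalePotential := by
  have h1 := le_potential (J := J) (by linarith)
  have h2 : ∀ a b, (a = 0 ∨ a = 1) → (b = 0 ∨ b = 1) → 0 ≤ (J.child a b).potential :=
    fun a b ha hb => by
      have := child_strainNorm_le (J := J) ha hb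
      have := (J.child a b).strainNorm_nonneg
      have := le_potential (J := J.child a b) (by linarith)
      linarith
  unfold twoScalePotential childAvg
  linarith [h2 0 0 (by simp) (by simp), h2 0 1 (by simp) (by simp), h2 1 0 (by simp) (by simp),
    h2 1 1 (by simp) (by simp)]

/-- After `k` dyadic subdivisions the truncated vorticity is within `ε` of its average. -/
def IsFine (ε : ℝ) : ℕ → PlaneMap → Prop
  | 0, J => J.truncVortAvg ≤ J.vortAvg ^ 2 + ε
  | k + 1, J => ∀ a b : ℝ, (a = 0 ∨ a = 1) → (b = 0 ∨ b = 1) → IsFine ε k (J.child a b)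

lemma truncVortAvg_le {ε : ℝ} (hε : 0 ≤ ε) (k : ℕ) :
    ∀ J : PlaneMap, IsFine ε k J → J.strainNorm ≤ 1 →
      J.truncVortAvg ≤ J.vortAvg ^ 2 + 456 * J.twoScalePotential + ε := by
  induction k with
  | zero =>
    intro J hJ hA
    have := le_twoScalePotential hA
    have := J.strainNorm_nonneg
    have : J.truncVortAvg ≤ J.vortAvg ^ 2 + ε := hJ
    linarith
  | succ k ih =>
    intro J hJ hA
    by_cases hc : ∀ a b : ℝ, (a = 0 ∨ a = 1) → (b = 0 ∨ b = 1) → (J.child a b).strainNorm ≤ 1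
    · have h1 : ∀ a b : ℝ, (a = 0 ∨ a = 1) → (b = 0 ∨ b = 1) → _ :=
        fun a b ha hb => ih _ (hJ a b ha hb) (hc a b ha hb)
      have h2 : childAvg truncVortAvg J ≤
          childAvg (fun K => K.vortAvg ^ 2 + 456 * K.twoScalePotential + ε) J := by
        unfold childAvg
        linarith [h1 0 0 (by simp) (by simp), h1 0 1 (by simp) (by simp),
          h1 1 0 (by simp) (by simp), h1 1 1 (by simp) (by simp)]
      rw [childAvg_add, childAvg_add, childAvg_const_mul, childAvg_const,
        ← truncVortAvg_eq_childAvg] at h2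
      linarith [J.childAvg_sq_vortAvg_le, J.childAvg_twoScalePotential_le]
    · push Not at hc
      obtain ⟨a, b, ha, hb, h⟩ := hc
      have h1 := child_strainNorm_le (J := J) ha hb
      have h2 := le_twoScalePotential hA
      have h3 := J.truncVortAvg_le_one
      nlinarith [sq_nonneg J.vortAvg]

lemma isFine_of_uniform {η : ℝ} (h0 : 0 ≤ η) (h1 : η ≤ 1) (k : ℕ) :
    ∀ (J : PlaneMap) (δ : ℝ), 1 ≤ 2 ^ k * δ →
      (∀ x ∈ Set.Icc (0 : ℝ) 1, ∀ y ∈ Set.Icc (0 : ℝ) 1, ∀ x' ∈ Set.Icc (0 : ℝ) 1,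
        ∀ y' ∈ Set.Icc (0 : ℝ) 1, |x - x'| ≤ δ → |y - y'| ≤ δ →
          |J.vort x y - J.vort x' y'| ≤ η) → IsFine (3 * η) k J := by
  induction k with
  | zero =>
    intro J δ hδ h
    have hW : ∀ x ∈ Set.Icc (0 : ℝ) 1, ∀ y ∈ Set.Icc (0 : ℝ) 1, |J.vort x y - J.vortAvg| ≤ η := by
      intro x hx y hy
      have hb : ∀ x' ∈ Set.Icc (0 : ℝ) 1, ∀ y' ∈ Set.Icc (0 : ℝ) 1,
          |J.vort x y - J.vort x' y'| ≤ η := fun x' hx' y' hy' =>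
        h x hx y hy x' hx' y' hy' (abs_le.2 ⟨by linarith [hx.1, hx'.2], by linarith [hx.2, hx'.1]⟩)
          (abs_le.2 ⟨by linarith [hy.1, hy'.2], by linarith [hy.2, hy'.1]⟩)
      have l := squareAvg_mono (g := fun _ _ => J.vort x y - η) continuous_const J.continuous_vort
        fun x' hx' y' hy' => by linarith [(abs_le.1 (hb x' hx' y' hy')).2]
      have u := squareAvg_mono (h := fun _ _ => J.vort x y + η) J.continuous_vort continuous_const
        fun x' hx' y' hy' => by linarith [(abs_le.1 (hb x' hx' y' hy')).1]
      rw [squareAvg_const] at l u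
      exact abs_le.2 ⟨by unfold vortAvg; linarith, by unfold vortAvg; linarith⟩
    refine (squareAvg_mono J.truncVort_continuous
      (h := fun _ _ => J.vortAvg ^ 2 + 3 * η) continuous_const fun x hx y hy => ?_).trans_eq
      (squareAvg_const _)
    have h2 := abs_le.1 (hW x hx y hy)
    by_cases hw : 1 ≤ J.vortAvg ^ 2
    · exact (min_le_right _ _).trans (by linarith)
    · refine (min_le_left _ _).trans ?_
      have h3 := abs_lt.1 ((sq_lt_one_iff_abs_lt_one _).1 (not_le.1 hw))
      nlinarith
  | succ k ih =>
    intro J δ hδ h a b ha hb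
    refine ih _ (2 * δ) (by rw [pow_succ] at hδ; linarith) ?_
    have hr : ∀ c : ℝ, (c = 0 ∨ c = 1) → ∀ x ∈ Set.Icc (0 : ℝ) 1,
        (x + c) / 2 ∈ Set.Icc (0 : ℝ) 1 := by
      rintro c (rfl | rfl) x hx <;> exact ⟨by linarith [hx.1], by linarith [hx.2]⟩
    have hd : ∀ c x x' : ℝ, |x - x'| ≤ 2 * δ → |(x + c) / 2 - (x' + c) / 2| ≤ δ := by
      intro c x x' hx
      rw [abs_le] at hx ⊢
      constructor <;> linarith
    intro x hx y hy x' hx' y' hy' hxx hyy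
    exact h _ (hr a ha x hx) _ (hr b hb y hy) _ (hr a ha x' hx') _ (hr b hb y' hy')
      (hd a x x' hxx) (hd b y y' hyy)

lemma exists_isFine (J : PlaneMap) {ε : ℝ} (hε : 0 < ε) : ∃ k, IsFine ε k J := by
  set η := min (ε / 3) 1 with hη
  have hη0 : 0 < η := lt_min (by linarith) one_pos
  have huc := (isCompact_Icc.prod isCompact_Icc :
    IsCompact (Set.Icc (0 : ℝ) 1 ×ˢ Set.Icc (0 : ℝ) 1)).uniformContinuousOn_of_continuous
    J.continuous_vort.continuousOn
  obtain ⟨δ, hδ, h⟩ := Metric.uniformContinuousOn_iff_le.1 huc η hη0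
  obtain ⟨k, hk⟩ := pow_unbounded_of_one_lt (1 / δ) (one_lt_two (α := ℝ))
  have hf : IsFine (3 * η) k J := by
    refine isFine_of_uniform hη0.le (min_le_right _ _) k J δ ?_ ?_
    · rw [div_lt_iff₀ hδ] at hk; exact hk.le
    · intro x hx y hy x' hx' y' hy' hxx hyy
      exact h (x, y) ⟨hx, hy⟩ (x', y') ⟨hx', hy'⟩
        (max_le (by simpa [Real.dist_eq] using hxx) (by simpa [Real.dist_eq] using hyy))
  have mono : ∀ k J, IsFine (3 * η) k J → IsFine ε k J := by
    intro k
    induction k with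
    | zero =>
      intro J hJ
      have h3 : η ≤ ε / 3 := min_le_left _ _
      exact le_trans hJ (by linarith)
    | succ k ih => exact fun J hJ a b ha hb => ih _ (hJ a b ha hb)
  exact ⟨k, mono k J hf⟩

/-- A plane map with mean zero vorticity and small strain has small vorticity. -/
theorem truncVortAvg_le_strainNorm {J : PlaneMap} (hW : J.vortAvg = 0) (hA : J.strainNorm ≤ 1) :
    J.truncVortAvg ≤ 291840 * J.strainNorm := by
  have hG : J.twoScalePotential ≤ 640 * J.strainNorm := by
    have h1 := J.potential_le
    have h2 := J.childAvg_potential_le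
    have h3 := J.childDev_nonneg
    unfold twoScalePotential
    linarith
  refine le_of_forall_pos_le_add fun ε hε => ?_
  obtain ⟨k, hk⟩ := J.exists_isFine hε
  have := truncVortAvg_le hε.le k J hk hA
  rw [hW] at this
  linarith

end PlaneMap

lemma volume_real_unitCube (n : ℕ) : (volume : Measure (Fin n → ℝ)).real (unitCube n) = 1 := by
  simp [unitCube, Measure.real, volume_pi_pi]

lemma measurableSet_unitCube (n : ℕ) : MeasurableSet (unitCube n) :=
  MeasurableSet.univ_pi fun _ => measurableSet_Ioo

lemma unitCube_subset_Icc (n : ℕ) : unitCube n ⊆ Set.Icc 0 1 := fun _ hx =>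
  ⟨fun i => (hx i trivial).1.le, fun i => (hx i trivial).2.le⟩

lemma integrableOn_unitCube {n : ℕ} {F : (Fin n → ℝ) → ℝ} (hF : Continuous F) :
    IntegrableOn F (unitCube n) :=
  (hF.continuousOn.integrableOn_compact isCompact_Icc).mono_set (unitCube_subset_Icc n)

lemma continuous_integral_unitCube {n : ℕ} {X : Type*} [TopologicalSpace X]
    [FirstCountableTopology X] [LocallyCompactSpace X] {F : X → (Fin n → ℝ) → ℝ}
    (hF : Continuous (Function.uncurry F)) : Continuous fun s => ∫ w in unitCube n, F s w := by
  have h : unitCube n =ᵐ[volume] Set.Icc 0 1 := Measure.univ_pi_Ioo_ae_eq_Icc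
  simp only [setIntegral_congr_set h]
  exact continuous_parametric_integral_of_continuous hF isCompact_Icc

lemma integral_unitCube_succ {n : ℕ} {F : (Fin (n + 1) → ℝ) → ℝ} (hF : Continuous F)
    (p : Fin (n + 1)) : ∫ x in unitCube (n + 1), F x =
      ∫ s in (0 : ℝ)..1, ∫ w in unitCube n, F (p.insertNth (α := fun _ => ℝ) s w) := by
  have hmp := (volume_preserving_piFinSuccAbove (fun _ : Fin (n + 1) => ℝ) p).symm
  have hset : (MeasurableEquiv.piFinSuccAbove (fun _ : Fin (n + 1) => ℝ) p).symm ⁻¹'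
      unitCube (n + 1) = Set.Ioo (0 : ℝ) 1 ×ˢ unitCube n := by
    ext ⟨s, w⟩
    change p.insertNth (α := fun _ => ℝ) s w ∈ unitCube (n + 1) ↔ _
    simp only [unitCube, Set.mem_pi, Set.mem_univ, true_imp_iff, Set.mem_prod]
    rw [p.forall_iff_succAbove]
    simp only [Fin.insertNth_apply_same, Fin.insertNth_apply_succAbove]
  have h := hmp.setIntegral_preimage_emb (MeasurableEquiv.measurableEmbedding _) F
    (unitCube (n + 1))
  rw [← h, hset, Measure.volume_eq_prod, setIntegral_prod,
    intervalIntegral.integral_of_le zero_le_one, integral_Ioc_eq_integral_Ioo]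
  · rfl
  · rw [← Measure.volume_eq_prod, ← hset]
    exact (hmp.integrableOn_comp_preimage (MeasurableEquiv.measurableEmbedding _)).2
      (integrableOn_unitCube hF)

lemma le_integral_unitCube_of_le_squareAvg {c : ℝ} (k : ℕ) :
    ∀ F : (Fin (k + 2) → ℝ) → ℝ, Continuous F →
      (∀ w : Fin k → ℝ, c ≤ squareAvg fun s t => F (Fin.cons s (Fin.cons t w))) →
      c ≤ ∫ x in unitCube (k + 2), F x := by
  induction k with
  | zero =>
    intro F hF h
    rw [integral_unitCube_succ hF 0]
    refine (h default).trans_eq ?_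
    unfold squareAvg
    congr 1
    funext s
    rw [integral_unitCube_succ (F := fun w => F (Fin.insertNth (α := fun _ => ℝ) 0 s w)) (by
      simp only [Fin.insertNth_zero']
      exact hF.comp (by fun_prop)) 0]
    congr 1
    funext t
    have : ∀ w : Fin 0 → ℝ, w = default := fun w => Subsingleton.elim _ _
    simp only [this, setIntegral_const, volume_real_unitCube, Fin.insertNth_zero', one_smul]
  | succ k ih =>
    intro F hF h
    rw [integral_unitCube_succ hF (Fin.last _)]
    have hc : Continuous fun p : ℝ × (Fin (k + 2) → ℝ) => F (Fin.snoc (α := fun _ => ℝ) p.2 p.1) :=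
      hF.comp (by fun_prop)
    have h1 : ∀ s, c ≤ ∫ w in unitCube (k + 2), F (Fin.snoc (α := fun _ => ℝ) w s) := by
      intro s
      refine ih _ (hc.comp (by fun_prop : Continuous fun w : Fin (k + 2) → ℝ => (s, w))) fun w => ?_
      have := h (Fin.snoc w s)
      simp only [Fin.cons_snoc_eq_snoc_cons] at this
      exact this
    simp only [Fin.insertNth_last']
    have hcont : Continuous fun s => ∫ w in unitCube (k + 2), F (Fin.snoc (α := fun _ => ℝ) w s) :=
      continuous_integral_unitCube hc
    calc c = ∫ s in (0 : ℝ)..1, c := by simp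
      _ ≤ _ := intervalIntegral.integral_mono_on zero_le_one (by simp)
          (hcont.intervalIntegrable _ _)
          fun s _ => h1 s

/-- Restriction of a scalar function to the plane spanned by the first two coordinates. -/
noncomputable def planeSection {k : ℕ} {ψ : (Fin (k + 2) → ℝ) → ℝ} (hψ : ContDiff ℝ 1 ψ)
    (w : Fin k → ℝ) : PlaneFun where
  val s t := ψ (Fin.cons s (Fin.cons t w))
  dx s t := fderiv ℝ ψ (Fin.cons s (Fin.cons t w)) (Pi.single 0 1)
  dy s t := fderiv ℝ ψ (Fin.cons s (Fin.cons t w)) (Pi.single 1 1)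
  cont := hψ.continuous.comp (by fun_prop)
  cont_dx := ((hψ.continuous_fderiv one_ne_zero).comp (by fun_prop)).clm_apply continuous_const
  cont_dy := ((hψ.continuous_fderiv one_ne_zero).comp (by fun_prop)).clm_apply continuous_const
  hasDeriv_dx x y := by
    have h := hasDerivAt_update (Fin.cons x (Fin.cons y w) : Fin (k + 2) → ℝ) 0 x
    have hd := ((hψ.differentiable one_ne_zero) (Fin.cons x (Fin.cons y w))).hasFDerivAt
    have he : Function.update (Fin.cons x (Fin.cons y w) : Fin (k + 2) → ℝ) 0 =
        fun s => (Fin.cons s (Fin.cons y w) : Fin (k + 2) → ℝ) :=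
      funext fun s => Fin.update_cons_zero _ _ _
    rw [he] at h
    exact hd.comp_hasDerivAt x h
  hasDeriv_dy x y := by
    have h := hasDerivAt_update (Fin.cons x (Fin.cons y w) : Fin (k + 2) → ℝ) (Fin.succ 0) y
    have hd := ((hψ.differentiable one_ne_zero) (Fin.cons x (Fin.cons y w))).hasFDerivAt
    have he : Function.update (Fin.cons x (Fin.cons y w) : Fin (k + 2) → ℝ) (Fin.succ 0) =
        fun t => (Fin.cons x (Fin.cons t w) : Fin (k + 2) → ℝ) := by
      funext t
      rw [← Fin.cons_update, Fin.update_cons_zero]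
    rw [he] at h
    exact hd.comp_hasDerivAt y h

lemma jacobianMatrix_apply {m n : ℕ} {φ : (Fin n → ℝ) → Fin m → ℝ} (hφ : Differentiable ℝ φ)
    (x : Fin n → ℝ) (i : Fin m) (j : Fin n) :
    jacobianMatrix φ x i j = fderiv ℝ (fun y => φ y i) x (Pi.single j 1) := by
  have h := hasFDerivAt_pi'.1 (hφ x).hasFDerivAt i
  rw [h.fderiv]
  rfl

lemma continuous_jacobianMatrix {m n : ℕ} {φ : (Fin n → ℝ) → Fin m → ℝ} (hφ : ContDiff ℝ 1 φ) :
    Continuous (jacobianMatrix φ) := by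
  refine continuous_pi fun i => continuous_pi fun j => ?_
  exact (continuous_apply i).comp
    ((hφ.continuous_fderiv one_ne_zero).clm_apply continuous_const)

/-- Strain together with the truncated vorticity defect in the plane of the first two
coordinates. -/
noncomputable def strainDefect {m k : ℕ} (i j : Fin m) (z : Matrix (Fin m) (Fin (k + 2)) ℝ) : ℝ :=
  |z i 0| + |z j 1| + |z i 1 + z j 0| + (1 - min ((z i 1 - z j 0) ^ 2) 1)

lemma PlaneMap.le_strainNorm_add (J : PlaneMap) (hJ : J.vortAvg = 0) :
    1 / 600000 ≤ J.strainNorm + (1 - J.truncVortAvg) := by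
  have h0 := J.strainNorm_nonneg
  have h1 := J.truncVortAvg_le_one
  rcases le_total J.strainNorm (1 / 600000) with h | h
  · have := PlaneMap.truncVortAvg_le_strainNorm hJ (h.trans (by norm_num))
    linarith
  · linarith

lemma le_integral_strainDefect {m k : ℕ} {φ : (Fin (k + 2) → ℝ) → Fin m → ℝ}
    (hφ : ContDiff ℝ 1 φ) (hsupp : tsupport φ ⊆ unitCube (k + 2)) (i j : Fin m) :
    1 / 600000 ≤ ∫ x in unitCube (k + 2), strainDefect i j (jacobianMatrix φ x) := by
  have hi : ∀ i, ContDiff ℝ 1 fun y => φ y i := contDiff_pi.1 hφ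
  have hzero : ∀ x, x ∉ unitCube (k + 2) → φ x = 0 := fun x hx =>
    image_eq_zero_of_notMem_tsupport fun h => hx (hsupp h)
  have hz0 : ∀ s t w, (s = 0 ∨ s = 1 ∨ t = 0 ∨ t = 1) →
      φ (Fin.cons s (Fin.cons t w)) = 0 := by
    intro s t w h
    refine hzero _ fun hx => ?_
    have h0 : s ∈ Set.Ioo (0 : ℝ) 1 := hx 0 trivial
    have h1 : t ∈ Set.Ioo (0 : ℝ) 1 := hx 1 trivial
    rcases h with rfl | rfl | rfl | rfl <;> simp at h0 h1
  have hJ := continuous_jacobianMatrix hφ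
  have hcoord : ∀ a b, Continuous fun x => jacobianMatrix φ x a b := fun a b => hJ.matrix_elem a b
  refine le_integral_unitCube_of_le_squareAvg k _ ?_ fun w => ?_
  · unfold strainDefect
    fun_prop
  · set J : PlaneMap := ⟨planeSection (hi i) w, planeSection (hi j) w⟩ with hJdef
    have hvort : J.vortAvg = 0 := by
      rw [J.vortAvg_eq]
      simp [hJdef, PlaneFun.top, PlaneFun.bottom, PlaneFun.left, PlaneFun.right, planeSection, hz0]
    refine (J.le_strainNorm_add hvort).trans_eq ?_
    have hd := hφ.differentiable one_ne_zero
    have heq : (fun s t => strainDefect i j (jacobianMatrix φ (Fin.cons s (Fin.cons t w)))) =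
        fun s t => ((|J.u.dx s t| + |J.v.dy s t|) + |J.shear s t|) +
          (1 - min (J.vort s t ^ 2) 1) := by
      funext s t
      simp only [strainDefect, jacobianMatrix_apply hd, PlaneMap.shear, PlaneMap.vort]
      rfl
    rw [heq, squareAvg_add, squareAvg_add, squareAvg_add, squareAvg_sub, squareAvg_const]
    · rfl
    · exact continuous_const
    · exact J.truncVort_continuous
    · exact J.u.cont_dx.abs
    · exact J.v.cont_dy.abs
    · exact J.u.cont_dx.abs.add J.v.cont_dy.abs
    · exact J.continuous_shear.abs
    · exact (J.u.cont_dx.abs.add J.v.cont_dy.abs).add J.continuous_shear.abs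
    · exact continuous_const.sub J.truncVort_continuous

lemma integral_zero_one_eq_sum {N : ℕ} (hN : N ≠ 0) {f : ℝ → ℝ} (hf : Continuous f) :
    ∫ s in (0 : ℝ)..1, f s = (N : ℝ)⁻¹ * ∑ a : Fin N, ∫ s in (0 : ℝ)..1, f ((s + a) / N) := by
  have hN' : (N : ℝ) ≠ 0 := by exact_mod_cast hN
  have h := intervalIntegral.sum_integral_adjacent_intervals (f := f) (μ := volume)
    (a := fun k : ℕ => (k : ℝ) / N) (n := N) fun k _ => hf.intervalIntegrable _ _
  have h2 : ∀ a : ℕ, ∫ s in (a / N : ℝ)..((a + 1 : ℕ) / N : ℝ), f s =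
      (N : ℝ)⁻¹ * ∫ s in (0 : ℝ)..1, f ((s + a) / N) := by
    intro a
    have := intervalIntegral.integral_comp_div_add (a := 0) (b := 1) f hN' ((a : ℝ) / N)
    simp only [add_div]
    rw [this, smul_eq_mul, inv_mul_cancel_left₀ hN']
    congr 1 <;> push_cast <;> ring
  rw [Finset.mul_sum, Fin.sum_univ_eq_sum_range
    (fun a => (N : ℝ)⁻¹ * ∫ s in (0 : ℝ)..1, f ((s + a) / N))]
  simp only [← h2, h]
  simp [hN']

lemma integral_unitCube_eq_sum {N : ℕ} (hN : N ≠ 0) (n : ℕ) :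
    ∀ F : (Fin n → ℝ) → ℝ, Continuous F →
      ∫ x in unitCube n, F x =
        (N : ℝ)⁻¹ ^ n * ∑ k : Fin n → Fin N, ∫ x in unitCube n, F fun i => (x i + k i) / N := by
  induction n with
  | zero =>
    intro F _
    have h0 : ∀ G : (Fin 0 → ℝ) → ℝ, ∫ x in unitCube 0, G x = G default := fun G => by
      rw [show G = fun _ => G default from funext fun x => congrArg G (Subsingleton.elim _ _)]
      simp [volume_real_unitCube]
    simp only [h0, pow_zero, one_mul, Finset.univ_unique, Finset.sum_singleton]
    exact congrArg F (Subsingleton.elim _ _)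
  | succ n ih =>
    intro F hF
    have hF2 : Continuous (Function.uncurry fun s (w : Fin n → ℝ) => F (Fin.cons s w)) :=
      hF.comp (f := fun p : ℝ × (Fin n → ℝ) => (Fin.cons p.1 p.2 : Fin (n + 1) → ℝ)) (by fun_prop)
    rw [integral_unitCube_succ hF 0]
    simp only [Fin.insertNth_zero']
    rw [integral_zero_one_eq_sum hN (continuous_integral_unitCube hF2),
      ← (Fin.consEquiv fun _ => Fin N).sum_comp, Fintype.sum_prod_type, pow_succ', mul_assoc,
      Finset.mul_sum (s := Finset.univ) (a := (N : ℝ)⁻¹ ^ n)]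
    congr 1
    refine Finset.sum_congr rfl fun a _ => ?_
    have h3 : ∀ s : ℝ, ∫ w in unitCube n, F (Fin.cons ((s + a) / N) w) = (N : ℝ)⁻¹ ^ n *
        ∑ k : Fin n → Fin N, ∫ w in unitCube n,
          F (Fin.cons ((s + a) / N) fun i => (w i + k i) / N) := fun s =>
      ih _ (hF.comp (by fun_prop))
    simp only [h3, intervalIntegral.integral_const_mul]
    congr 1
    rw [intervalIntegral.integral_finsetSum]
    · refine Finset.sum_congr rfl fun k _ => ?_
      have hk : Continuous fun x : Fin (n + 1) → ℝ =>
          F fun i => (x i + (Fin.consEquiv (fun _ => Fin N) (a, k) i : ℕ)) / N :=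
        hF.comp (by fun_prop)
      rw [integral_unitCube_succ hk 0]
      congr 1
      funext s
      congr 1
      funext w
      congr 1
      funext i
      refine Fin.cases ?_ (fun i => ?_) i <;> simp [Fin.insertNth_zero', Fin.consEquiv]
    · intro k _
      refine (continuous_integral_unitCube ?_).intervalIntegrable _ _
      exact hF.comp (f := fun p : ℝ × (Fin n → ℝ) =>
        (Fin.cons ((p.1 + a) / N) fun i => (p.2 i + k i) / N : Fin (n + 1) → ℝ)) (by fun_prop)

/-- Admissible test maps for quasiconvexity. -/
structure IsTestMap {m n : ℕ} (φ : (Fin n → ℝ) → Fin m → ℝ) : Prop where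
  smooth : ContDiff ℝ (⊤ : ℕ∞) φ
  tsupport_subset : tsupport φ ⊆ unitCube n

namespace IsTestMap

variable {m n : ℕ} {φ ψ : (Fin n → ℝ) → Fin m → ℝ}

lemma hasCompactSupport (h : IsTestMap φ) : HasCompactSupport φ :=
  isCompact_Icc.of_isClosed_subset (isClosed_tsupport φ)
    (h.tsupport_subset.trans (unitCube_subset_Icc n))

lemma contDiff_one (h : IsTestMap φ) : ContDiff ℝ 1 φ := h.smooth.of_le (by simp)

lemma differentiable (h : IsTestMap φ) : Differentiable ℝ φ :=
  h.contDiff_one.differentiable one_ne_zero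

lemma continuous_jacobian (h : IsTestMap φ) : Continuous (jacobianMatrix φ) :=
  continuous_jacobianMatrix h.contDiff_one

lemma zero : IsTestMap (0 : (Fin n → ℝ) → Fin m → ℝ) where
  smooth := contDiff_const
  tsupport_subset := by simp [tsupport]

lemma add (hφ : IsTestMap φ) (hψ : IsTestMap ψ) : IsTestMap (φ + ψ) where
  smooth := hφ.smooth.add hψ.smooth
  tsupport_subset :=
    (tsupport_add φ ψ).trans (Set.union_subset hφ.tsupport_subset hψ.tsupport_subset)

lemma const_smul (h : IsTestMap φ) (c : ℝ) : IsTestMap (c • φ) where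
  smooth := h.smooth.const_smul c
  tsupport_subset := (closure_mono (Function.support_const_smul_subset c φ)).trans h.tsupport_subset

lemma sum {ι : Type*} (s : Finset ι) {φ : ι → (Fin n → ℝ) → Fin m → ℝ}
    (h : ∀ i, IsTestMap (φ i)) : IsTestMap (∑ i ∈ s, φ i) :=
  Finset.sum_induction _ _ (fun _ _ => add) zero fun i _ => h i

lemma jacobian_eq_zero (h : IsTestMap φ) {x : Fin n → ℝ} (hx : x ∉ unitCube n) :
    jacobianMatrix φ x = 0 := by
  have : fderiv ℝ φ x = 0 :=
    image_eq_zero_of_notMem_tsupport fun h' => hx (h.tsupport_subset (tsupport_fderiv_subset ℝ h'))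
  ext i j
  simp [jacobianMatrix, this]

end IsTestMap

section CubeCopies

variable {m n : ℕ}

lemma jacobianMatrix_add {φ ψ : (Fin n → ℝ) → Fin m → ℝ} (hφ : Differentiable ℝ φ)
    (hψ : Differentiable ℝ ψ) (x : Fin n → ℝ) :
    jacobianMatrix (φ + ψ) x = jacobianMatrix φ x + jacobianMatrix ψ x := by
  ext i j
  simp [jacobianMatrix, fderiv_add (hφ x) (hψ x)]

lemma jacobianMatrix_const_smul {φ : (Fin n → ℝ) → Fin m → ℝ} (hφ : Differentiable ℝ φ) (c : ℝ)
    (x : Fin n → ℝ) : jacobianMatrix (c • φ) x = c • jacobianMatrix φ x := by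
  ext i j
  simp [jacobianMatrix, fderiv_const_smul (hφ x)]

lemma jacobianMatrix_sum {ι : Type*} (s : Finset ι) {φ : ι → (Fin n → ℝ) → Fin m → ℝ}
    (hφ : ∀ i, Differentiable ℝ (φ i)) (x : Fin n → ℝ) :
    jacobianMatrix (∑ i ∈ s, φ i) x = ∑ i ∈ s, jacobianMatrix (φ i) x := by
  ext a b
  simp [jacobianMatrix, fderiv_sum fun i _ => hφ i x, Matrix.sum_apply]

/-- The copy of `φ` living in the cube of side length `1 / N` with lower corner `k / N`. -/
noncomputable def cubeCopy {N : ℕ} (k : Fin n → Fin N) (φ : (Fin n → ℝ) → Fin m → ℝ) :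
    (Fin n → ℝ) → Fin m → ℝ :=
  fun x => (N : ℝ)⁻¹ • φ fun i => N * x i - k i

lemma IsTestMap.cubeCopy {N : ℕ} (hN : N ≠ 0) (k : Fin n → Fin N)
    {φ : (Fin n → ℝ) → Fin m → ℝ} (h : IsTestMap φ) : IsTestMap (cubeCopy k φ) where
  smooth := by
    refine ContDiff.const_smul _ (h.smooth.comp ?_)
    fun_prop
  tsupport_subset := by
    have hc : Continuous fun (x : Fin n → ℝ) (i : Fin n) => (N : ℝ) * x i - (k i : ℕ) := by fun_prop
    have hsub : tsupport (_root_.cubeCopy k φ) ⊆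
        (fun (x : Fin n → ℝ) (i : Fin n) => (N : ℝ) * x i - (k i : ℕ)) ⁻¹' tsupport φ := by
      refine closure_minimal (fun x hx => subset_tsupport φ fun h0 => hx ?_)
        ((isClosed_tsupport φ).preimage hc)
      simp [_root_.cubeCopy, h0]
    intro x hx i _
    have hi := h.tsupport_subset (hsub hx) i trivial
    have hN' : (0 : ℝ) < N := by positivity
    have hk : ((k i : ℕ) : ℝ) + 1 ≤ N := by exact_mod_cast (k i).2
    have hk0 : (0 : ℝ) ≤ (k i : ℕ) := Nat.cast_nonneg _
    simp only [Set.mem_Ioo] at hi ⊢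
    constructor <;> nlinarith

lemma jacobianMatrix_cubeCopy {N : ℕ} (hN : N ≠ 0) (k : Fin n → Fin N)
    {φ : (Fin n → ℝ) → Fin m → ℝ} (hφ : Differentiable ℝ φ) (x : Fin n → ℝ) :
    jacobianMatrix (cubeCopy k φ) x = jacobianMatrix φ fun i => N * x i - k i := by
  have hN' : (N : ℝ) ≠ 0 := by exact_mod_cast hN
  have hd : HasFDerivAt (fun (x : Fin n → ℝ) (i : Fin n) => (N : ℝ) * x i - (k i : ℕ))
      ((N : ℝ) • ContinuousLinearMap.id ℝ (Fin n → ℝ)) x :=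
    ((hasFDerivAt_id x).const_smul (N : ℝ)).sub_const (fun i => ((k i : ℕ) : ℝ))
  have := ((hφ _).hasFDerivAt.comp x hd).const_smul (N : ℝ)⁻¹
  have h2 : HasFDerivAt (cubeCopy k φ) _ x := this
  ext i j
  simp [jacobianMatrix, h2.fderiv, hN']

lemma notMem_unitCube_of_ne {N : ℕ} {k l : Fin n → Fin N} (hkl : k ≠ l) {y : Fin n → ℝ}
    (hy : y ∈ unitCube n) : (fun i => y i + (k i : ℕ) - (l i : ℕ) : Fin n → ℝ) ∉ unitCube n := by
  intro h
  refine hkl (funext fun i => ?_)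
  have h1 : y i ∈ Set.Ioo (0 : ℝ) 1 := hy i trivial
  have h2 : y i + (k i : ℕ) - (l i : ℕ) ∈ Set.Ioo (0 : ℝ) 1 := h i trivial
  have h3 : ((k i : ℕ) : ℝ) < (l i : ℕ) + 1 := by linarith [h1.1, h2.2]
  have h4 : ((l i : ℕ) : ℝ) < (k i : ℕ) + 1 := by linarith [h1.2, h2.1]
  have h3' : (k i : ℕ) < (l i : ℕ) + 1 := by exact_mod_cast h3
  have h4' : (l i : ℕ) < (k i : ℕ) + 1 := by exact_mod_cast h4
  exact Fin.ext (by omega)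

/-- A test map obtained from `ψ` by adding to it a copy of `φ k` in the cube with corner `k / N`. -/
noncomputable def patch {N : ℕ} (ψ : (Fin n → ℝ) → Fin m → ℝ)
    (φ : (Fin n → Fin N) → (Fin n → ℝ) → Fin m → ℝ) : (Fin n → ℝ) → Fin m → ℝ :=
  ψ + ∑ k, cubeCopy k (φ k)

lemma IsTestMap.patch {N : ℕ} (hN : N ≠ 0) {ψ : (Fin n → ℝ) → Fin m → ℝ} (hψ : IsTestMap ψ)
    {φ : (Fin n → Fin N) → (Fin n → ℝ) → Fin m → ℝ} (hφ : ∀ k, IsTestMap (φ k)) :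
    IsTestMap (patch ψ φ) :=
  hψ.add (IsTestMap.sum _ fun k => (hφ k).cubeCopy hN k)

lemma jacobianMatrix_patch {N : ℕ} (hN : N ≠ 0) {ψ : (Fin n → ℝ) → Fin m → ℝ} (hψ : IsTestMap ψ)
    {φ : (Fin n → Fin N) → (Fin n → ℝ) → Fin m → ℝ} (hφ : ∀ k, IsTestMap (φ k))
    (k : Fin n → Fin N) {y : Fin n → ℝ} (hy : y ∈ unitCube n) :
    jacobianMatrix (patch ψ φ) (fun i => (y i + k i) / N) =
      jacobianMatrix ψ (fun i => (y i + k i) / N) + jacobianMatrix (φ k) y := by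
  have hN' : (N : ℝ) ≠ 0 := by exact_mod_cast hN
  have hc : ∀ k, IsTestMap (cubeCopy k (φ k)) := fun k => (hφ k).cubeCopy hN k
  rw [patch, jacobianMatrix_add hψ.differentiable (IsTestMap.sum _ hc).differentiable,
    jacobianMatrix_sum _ fun k => (hc k).differentiable]
  congr 1
  simp only [fun l => jacobianMatrix_cubeCopy hN l (hφ l).differentiable]
  rw [Finset.sum_eq_single k]
  · congr 1
    funext i
    field_simp
    ring
  · intro l _ hl
    have : (fun i => (N : ℝ) * ((y i + (k i : ℕ)) / N) - (l i : ℕ)) =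
        fun i => y i + (k i : ℕ) - (l i : ℕ) := by
      funext i
      field_simp
    rw [this]
    exact (hφ l).jacobian_eq_zero (notMem_unitCube_of_ne hl.symm hy)
  · simp

end CubeCopies

section Envelope

attribute [local instance] Matrix.normedAddCommGroup Matrix.normedSpace

variable {m n : ℕ}

/-- The quasiconvex envelope, through Dacorogna's formula. -/
noncomputable def qcEnvelope (h : Matrix (Fin m) (Fin n) ℝ → ℝ)
    (z : Matrix (Fin m) (Fin n) ℝ) : ℝ :=
  ⨅ φ : {φ : (Fin n → ℝ) → Fin m → ℝ // IsTestMap φ},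
    ∫ x in unitCube n, h (z + jacobianMatrix φ.1 x)

instance : Nonempty {φ : (Fin n → ℝ) → Fin m → ℝ // IsTestMap φ} := ⟨⟨0, IsTestMap.zero⟩⟩

lemma setIntegral_unitCube_mono {F G : (Fin n → ℝ) → ℝ} (hF : Continuous F) (hG : Continuous G)
    (h : ∀ x ∈ unitCube n, F x ≤ G x) : ∫ x in unitCube n, F x ≤ ∫ x in unitCube n, G x :=
  setIntegral_mono_on (integrableOn_unitCube hF) (integrableOn_unitCube hG)
    (measurableSet_unitCube n) h

lemma integral_unitCube_add_const {F : (Fin n → ℝ) → ℝ} (hF : Continuous F) (c : ℝ) :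
    ∫ x in unitCube n, (F x + c) = (∫ x in unitCube n, F x) + c := by
  rw [integral_add (integrableOn_unitCube hF) (integrableOn_unitCube continuous_const)]
  simp [volume_real_unitCube]

section

variable {h : Matrix (Fin m) (Fin n) ℝ → ℝ}

lemma qcEnvelope_le (h0 : ∀ z, 0 ≤ h z) {φ : (Fin n → ℝ) → Fin m → ℝ} (hφ : IsTestMap φ)
    (z : Matrix (Fin m) (Fin n) ℝ) :
    qcEnvelope h z ≤ ∫ x in unitCube n, h (z + jacobianMatrix φ x) :=
  ciInf_le (f := fun φ : {φ : (Fin n → ℝ) → Fin m → ℝ // IsTestMap φ} =>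
    ∫ x in unitCube n, h (z + jacobianMatrix φ.1 x))
    ⟨0, by rintro _ ⟨φ, rfl⟩; exact integral_nonneg fun x => h0 _⟩ ⟨φ, hφ⟩

lemma qcEnvelope_nonneg (h0 : ∀ z, 0 ≤ h z) (z : Matrix (Fin m) (Fin n) ℝ) :
    0 ≤ qcEnvelope h z :=
  Real.iInf_nonneg fun _ => integral_nonneg fun _ => h0 _

lemma qcEnvelope_le_self (h0 : ∀ z, 0 ≤ h z) (z : Matrix (Fin m) (Fin n) ℝ) :
    qcEnvelope h z ≤ h z := by
  refine (qcEnvelope_le h0 IsTestMap.zero z).trans_eq ?_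
  have : ∀ x, jacobianMatrix (0 : (Fin n → ℝ) → Fin m → ℝ) x = 0 := fun x => by
    ext i j
    simp [jacobianMatrix]
  simp [this, volume_real_unitCube]

end

lemma exists_lt_qcEnvelope_add (h : Matrix (Fin m) (Fin n) ℝ → ℝ) (z : Matrix (Fin m) (Fin n) ℝ)
    {ε : ℝ} (hε : 0 < ε) : ∃ φ : (Fin n → ℝ) → Fin m → ℝ, IsTestMap φ ∧
      ∫ x in unitCube n, h (z + jacobianMatrix φ x) < qcEnvelope h z + ε := by
  obtain ⟨φ, hφ⟩ := exists_lt_of_ciInf_lt (lt_add_of_pos_right (qcEnvelope h z) hε)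
  exact ⟨φ.1, φ.2, hφ⟩

lemma LipschitzWith.le_add_norm_sub {h : Matrix (Fin m) (Fin n) ℝ → ℝ} {K : NNReal}
    (hK : LipschitzWith K h) (z w : Matrix (Fin m) (Fin n) ℝ) : h z ≤ h w + K * ‖z - w‖ := by
  have := hK.dist_le_mul z w
  rw [Real.dist_eq, dist_eq_norm] at this
  linarith [le_abs_self (h z - h w)]

lemma IsTestMap.continuous_comp_jacobian {φ : (Fin n → ℝ) → Fin m → ℝ} (hφ : IsTestMap φ)
    {h : Matrix (Fin m) (Fin n) ℝ → ℝ} (hh : Continuous h) (z : Matrix (Fin m) (Fin n) ℝ) :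
    Continuous fun x => h (z + jacobianMatrix φ x) :=
  hh.comp (continuous_const.add hφ.continuous_jacobian)

variable {h : Matrix (Fin m) (Fin n) ℝ → ℝ} {K : NNReal}

lemma lipschitzWith_qcEnvelope (h0 : ∀ z, 0 ≤ h z) (hK : LipschitzWith K h) :
    LipschitzWith K (qcEnvelope h) := by
  refine LipschitzWith.of_le_add_mul K fun z w => le_of_forall_pos_le_add fun ε hε => ?_
  obtain ⟨φ, hφ, hlt⟩ := exists_lt_qcEnvelope_add h w hε
  refine (qcEnvelope_le h0 hφ z).trans ?_
  have hc := fun z => hφ.continuous_comp_jacobian hK.continuous z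
  have : ∫ x in unitCube n, h (z + jacobianMatrix φ x) ≤
      ∫ x in unitCube n, (h (w + jacobianMatrix φ x) + K * dist z w) := by
    refine setIntegral_unitCube_mono (hc z) ((hc w).add continuous_const) fun x _ => ?_
    have := hK.le_add_norm_sub (z + jacobianMatrix φ x) (w + jacobianMatrix φ x)
    rwa [add_sub_add_right_eq_sub, ← dist_eq_norm] at this
  rw [integral_unitCube_add_const (hc w)] at this
  linarith

lemma IsTestMap.exists_cubes {ψ : (Fin n → ℝ) → Fin m → ℝ} (hψ : IsTestMap ψ) {ε : ℝ}
    (hε : 0 < ε) : ∃ N : ℕ, N ≠ 0 ∧ ∀ (k : Fin n → Fin N), ∀ y ∈ unitCube n,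
      ‖jacobianMatrix ψ (fun i => (y i + (k i : ℕ)) / N) -
        jacobianMatrix ψ (fun i => (k i : ℕ) / N)‖ ≤ ε := by
  have hu := isCompact_Icc (a := (0 : Fin n → ℝ)) (b := 1) |>.uniformContinuousOn_of_continuous
    hψ.continuous_jacobian.continuousOn
  obtain ⟨δ, hδ, hd⟩ := Metric.uniformContinuousOn_iff.1 hu ε hε
  obtain ⟨N, hN⟩ := exists_nat_gt δ⁻¹
  have hN0 : (0 : ℝ) < N := (inv_pos.2 hδ).trans hN
  refine ⟨N, by exact_mod_cast hN0.ne', fun k y hy => ?_⟩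
  have hk0 : ∀ i, (0 : ℝ) ≤ (k i : ℕ) := fun i => Nat.cast_nonneg _
  have hk1 : ∀ i, ((k i : ℕ) : ℝ) + 1 ≤ N := fun i => by exact_mod_cast (k i).2
  have hy' : ∀ i, y i ∈ Set.Ioo (0 : ℝ) 1 := fun i => hy i trivial
  rw [← dist_eq_norm]
  refine (hd _ ⟨fun i => ?_, fun i => ?_⟩ _ ⟨fun i => ?_, fun i => ?_⟩ ?_).le
  · exact div_nonneg (add_nonneg (hy' i).1.le (hk0 i)) hN0.le
  · exact (div_le_one hN0).2 (by linarith [(hy' i).2, hk1 i])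
  · exact div_nonneg (hk0 i) hN0.le
  · exact (div_le_one hN0).2 (by linarith [hk1 i])
  · refine (dist_pi_lt_iff hδ).2 fun i => ?_
    rw [Real.dist_eq, ← sub_div, add_sub_cancel_right, abs_of_pos (div_pos (hy' i).1 hN0),
      div_lt_iff₀ hN0]
    have := (inv_lt_iff_one_lt_mul₀ hδ).1 hN
    linarith [(hy' i).2]

lemma isQuasiconvex_qcEnvelope (h0 : ∀ z, 0 ≤ h z) (hK : LipschitzWith K h) :
    IsQuasiconvex (qcEnvelope h) := by
  intro z ψ hs _ ht
  have hψ : IsTestMap ψ := ⟨hs, ht⟩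
  have hQ := lipschitzWith_qcEnvelope h0 hK
  refine le_of_forall_pos_le_add fun ε' hε' => ?_
  obtain ⟨ε, hε, hεε'⟩ : ∃ ε > 0, (1 + 2 * K) * ε = ε' :=
    ⟨ε' / (1 + 2 * K), by positivity, by field_simp⟩
  obtain ⟨N, hN, hosc⟩ := hψ.exists_cubes hε
  choose φ hφ hlt using fun k : Fin n → Fin N =>
    exists_lt_qcEnvelope_add h (z + jacobianMatrix ψ fun i => (k i : ℕ) / N) hε
  have hp := hψ.patch hN hφ
  have hQc := hψ.continuous_comp_jacobian hQ.continuous z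
  have hcell : ∀ k : Fin n → Fin N,
      ∫ y in unitCube n, h (z + jacobianMatrix (patch ψ φ) fun i => (y i + (k i : ℕ)) / N) ≤
      (∫ y in unitCube n, qcEnvelope h (z + jacobianMatrix ψ fun i => (y i + (k i : ℕ)) / N)) +
        ε' := by
    intro k
    have hmap : Continuous fun (y : Fin n → ℝ) (i : Fin n) => (y i + (k i : ℕ)) / (N : ℝ) := by
      fun_prop
    have hc1 := (hp.continuous_comp_jacobian hK.continuous z).comp hmap
    have hc2 := (hφ k).continuous_comp_jacobian hK.continuous
      (z + jacobianMatrix ψ fun i => (k i : ℕ) / N)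
    have hc3 : Continuous fun y : Fin n → ℝ =>
        qcEnvelope h (z + jacobianMatrix ψ fun i => (y i + (k i : ℕ)) / N) := hQc.comp hmap
    have h1 : ∫ y in unitCube n, h (z + jacobianMatrix (patch ψ φ) fun i => (y i + (k i : ℕ)) / N) ≤
        ∫ y in unitCube n, (h (z + (jacobianMatrix ψ fun i => (k i : ℕ) / N) +
          jacobianMatrix (φ k) y) + K * ε) := by
      refine setIntegral_unitCube_mono hc1 (hc2.add continuous_const) fun y hy => ?_
      rw [jacobianMatrix_patch hN hψ hφ k hy]
      refine (hK.le_add_norm_sub _ _).trans (add_le_add_right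
        (mul_le_mul_of_nonneg_left ((congrArg norm ?_).trans_le (hosc k y hy)) K.2) _)
      abel
    have h2 : ∫ y in unitCube n, qcEnvelope h (z + jacobianMatrix ψ fun i => (k i : ℕ) / N) ≤
        ∫ y in unitCube n,
          (qcEnvelope h (z + jacobianMatrix ψ fun i => (y i + (k i : ℕ)) / N) + K * ε) := by
      refine setIntegral_unitCube_mono continuous_const (hc3.add continuous_const) fun y hy => ?_
      refine (hQ.le_add_norm_sub _ _).trans (add_le_add_right
        (mul_le_mul_of_nonneg_left ((congrArg norm ?_).trans_le ((norm_sub_rev _ _).trans_le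
          (hosc k y hy))) K.2) _)
      abel
    rw [integral_unitCube_add_const hc2] at h1
    rw [integral_unitCube_add_const hc3] at h2
    simp only [setIntegral_const, volume_real_unitCube, one_smul] at h2
    have h3 := hlt k
    linarith
  refine (qcEnvelope_le h0 hp z).trans ?_
  rw [integral_unitCube_eq_sum hN n _ (hp.continuous_comp_jacobian hK.continuous z),
    integral_unitCube_eq_sum hN n _ hQc]
  have hNp : (N : ℝ)⁻¹ ^ n * ∑ _k : Fin n → Fin N, ε' = ε' := by
    have : (N : ℝ) ≠ 0 := by exact_mod_cast hN
    simp [this]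
  rw [← hNp, ← mul_add, ← Finset.sum_add_distrib]
  exact mul_le_mul_of_nonneg_left (Finset.sum_le_sum fun k _ => hcell k) (by positivity)

end Envelope

section Distance

variable {m n : ℕ}

lemma frobNorm_nonneg (z : Matrix (Fin m) (Fin n) ℝ) : 0 ≤ frobNorm z := Real.sqrt_nonneg _

lemma frobNorm_smul (t : ℝ) (z : Matrix (Fin m) (Fin n) ℝ) :
    frobNorm (t • z) = |t| * frobNorm z := by
  simp only [frobNorm, Matrix.smul_apply, smul_eq_mul, mul_pow, ← Finset.mul_sum]
  rw [Real.sqrt_mul (sq_nonneg t), Real.sqrt_sq_eq_abs]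

lemma abs_entry_le_frobNorm (z : Matrix (Fin m) (Fin n) ℝ) (i : Fin m) (j : Fin n) :
    |z i j| ≤ frobNorm z := by
  refine Real.abs_le_sqrt ((Finset.single_le_sum (f := fun j => z i j ^ 2)
    (fun j _ => sq_nonneg _) (Finset.mem_univ j)).trans ?_)
  exact Finset.single_le_sum (f := fun i => ∑ j, z i j ^ 2)
    (fun i _ => Finset.sum_nonneg fun j _ => sq_nonneg _) (Finset.mem_univ i)

lemma abs_sub_le_dLG {f g : Matrix (Fin m) (Fin n) ℝ → ℝ} (hf : HasLinearGrowth f)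
    (hg : HasLinearGrowth g) (z : Matrix (Fin m) (Fin n) ℝ) :
    |f z - g z| ≤ dLG f g * (1 + frobNorm z) := by
  obtain ⟨C, _, hC⟩ := hf
  obtain ⟨C', _, hC'⟩ := hg
  have hpos : ∀ z : Matrix (Fin m) (Fin n) ℝ, 0 < 1 + frobNorm z := fun z => by
    linarith [frobNorm_nonneg z]
  rw [← div_le_iff₀ (hpos z)]
  refine le_ciSup (f := fun z => |f z - g z| / (1 + frobNorm z)) ⟨C + C', ?_⟩ z
  rintro _ ⟨w, rfl⟩
  rw [div_le_iff₀ (hpos w)]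
  have := abs_sub (f w) (g w)
  linarith [hC w, hC' w]

end Distance

section

attribute [local instance] Matrix.normedAddCommGroup Matrix.normedSpace

lemma norm_le_frobNorm {m n : ℕ} (z : Matrix (Fin m) (Fin n) ℝ) : ‖z‖ ≤ frobNorm z :=
  (Matrix.norm_le_iff (frobNorm_nonneg z)).2 fun i j => abs_entry_le_frobNorm z i j

lemma LipschitzWith.hasLinearGrowth {m n : ℕ} {f : Matrix (Fin m) (Fin n) ℝ → ℝ} {K : NNReal}
    (hf : LipschitzWith K f) : HasLinearGrowth f := by
  refine ⟨|f 0| + K, by positivity, fun z => ?_⟩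
  have h1 := hf.dist_le_mul z 0
  rw [Real.dist_eq, dist_zero_right] at h1
  have h2 := abs_sub_abs_le_abs_sub (f z) (f 0)
  have h3 := mul_le_mul_of_nonneg_left (norm_le_frobNorm z) K.2
  have h4 := mul_nonneg (abs_nonneg (f 0)) (frobNorm_nonneg z)
  have h5 : (0 : ℝ) ≤ K := K.2
  simp only [NNReal.val_eq_coe] at h3
  linarith

end

/-- The values of the vorticity which are not penalized by `vortexEnergy S`. -/
def vortexWells (S : Set ℕ) : Set ℝ := insert 0 ((fun j : ℕ => 2 * 4 ^ j) '' Sᶜ)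

lemma three_halves_mul_le_abs_sub {S : Set ℕ} {k : ℕ} (hk : k ∈ S) {p : ℝ}
    (hp : p ∈ vortexWells S) : 3 / 2 * 4 ^ k ≤ |2 * 4 ^ k - p| := by
  have h4 : (0 : ℝ) < 4 ^ k := by positivity
  rcases hp with rfl | ⟨j, hj, rfl⟩
  · rw [sub_zero, abs_of_pos (by positivity)]
    linarith
  · rcases lt_trichotomy j k with h | rfl | h
    · have : (4 : ℝ) ^ (j + 1) ≤ 4 ^ k := pow_le_pow_right₀ (by norm_num) h
      refine le_trans ?_ (le_abs_self _)
      rw [pow_succ] at this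
      linarith
    · exact absurd hk hj
    · have : (4 : ℝ) ^ (k + 1) ≤ 4 ^ j := pow_le_pow_right₀ (by norm_num) h
      refine le_trans ?_ (neg_le_abs _)
      rw [pow_succ] at this
      linarith

lemma le_infDist_vortexWells {S : Set ℕ} {k : ℕ} (hk : k ∈ S) (d : ℝ) :
    4 ^ k * (1 - min (((4 ^ k)⁻¹ * d) ^ 2) 1) ≤ Metric.infDist (2 * 4 ^ k + d) (vortexWells S) := by
  have h4 : (0 : ℝ) < 4 ^ k := by positivity
  refine (Metric.le_infDist ⟨0, Set.mem_insert _ _⟩).2 fun p hp => ?_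
  rw [Real.dist_eq]
  have h1 := three_halves_mul_le_abs_sub hk hp
  have h2 := abs_sub_abs_le_abs_sub (2 * 4 ^ k - p) (-d)
  rw [abs_neg, show 2 * 4 ^ k - p - -d = 2 * 4 ^ k + d - p by ring] at h2
  obtain ⟨r, rfl⟩ : ∃ r, d = 4 ^ k * r := ⟨d / 4 ^ k, by field_simp⟩
  rw [inv_mul_cancel_left₀ h4.ne']
  rw [abs_mul, abs_of_pos h4] at h2
  rcases min_cases (r ^ 2) 1 with ⟨h, _⟩ | ⟨h, _⟩ <;> rw [h]
  · have : 1 - r ^ 2 ≤ 3 / 2 - |r| := by nlinarith [sq_abs r, sq_nonneg (|r| - 1 / 2)]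
    have := mul_le_mul_of_nonneg_left this h4.le
    linarith
  · simp

section VortexEnergy

variable {m k : ℕ}

/-- An energy vanishing on strain-free matrices with vorticity in `vortexWells S`. -/
noncomputable def vortexEnergy (i j : Fin m) (S : Set ℕ) (z : Matrix (Fin m) (Fin (k + 2)) ℝ) : ℝ :=
  |z i 0| + |z j 1| + |z i 1 + z j 0| + Metric.infDist (z i 1 - z j 0) (vortexWells S)

/-- The elementary infinitesimal rotation in the rows `i` and `j`. -/
def rotationGenerator (i j : Fin m) : Matrix (Fin m) (Fin (k + 2)) ℝ :=
  Matrix.single i 1 1 - Matrix.single j 0 1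

lemma vortexEnergy_nonneg (i j : Fin m) (S : Set ℕ) (z : Matrix (Fin m) (Fin (k + 2)) ℝ) :
    0 ≤ vortexEnergy i j S z :=
  add_nonneg (by positivity) Metric.infDist_nonneg

lemma vortexEnergy_rotation {i j : Fin m} (hij : i ≠ j) {S : Set ℕ} {l : ℕ} (hl : l ∉ S) :
    vortexEnergy (k := k) i j S ((4 ^ l : ℝ) • rotationGenerator i j) = 0 := by
  have hmem : (4 ^ l + 4 ^ l : ℝ) ∈ vortexWells S :=
    Or.inr ⟨l, hl, by ring⟩
  simp [vortexEnergy, rotationGenerator, hij, hij.symm, Metric.infDist_zero_of_mem hmem]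

lemma le_vortexEnergy {i j : Fin m} (hij : i ≠ j) {S : Set ℕ} {l : ℕ} (hl : l ∈ S)
    (w : Matrix (Fin m) (Fin (k + 2)) ℝ) :
    4 ^ l * strainDefect i j ((4 ^ l : ℝ)⁻¹ • w) ≤
      vortexEnergy i j S ((4 ^ l : ℝ) • rotationGenerator i j + w) := by
  have h4 : (0 : ℝ) < 4 ^ l := by positivity
  have h := le_infDist_vortexWells hl (w i 1 - w j 0)
  have habs : ∀ x : ℝ, 4 ^ l * |(4 ^ l)⁻¹ * x| = |x| := fun x => by
    rw [abs_mul, abs_of_pos (inv_pos.2 h4), mul_inv_cancel_left₀ h4.ne']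
  simp only [strainDefect, vortexEnergy, rotationGenerator, Matrix.add_apply, Matrix.smul_apply,
    Matrix.sub_apply, Matrix.single_apply, smul_eq_mul, hij, hij.symm, ← mul_add, ← mul_sub] at *
  simp only [mul_add (4 ^ l : ℝ), habs]
  simp
  ring_nf at h ⊢
  linarith

section

attribute [local instance] Matrix.normedAddCommGroup Matrix.normedSpace

lemma lipschitzWith_vortexEnergy (i j : Fin m) (S : Set ℕ) :
    LipschitzWith 6 (vortexEnergy (k := k) i j S) := by
  have hentry : ∀ a b, LipschitzWith 1 fun z : Matrix (Fin m) (Fin (k + 2)) ℝ => z a b := fun a b =>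
    LipschitzWith.of_dist_le_mul fun z w => by
      rw [NNReal.coe_one, one_mul, Real.dist_eq, dist_eq_norm]
      exact (z - w).norm_entry_le_entrywise_sup_norm
  have habs : LipschitzWith 1 fun x : ℝ => |x| := lipschitzWith_one_norm
  have h := ((((habs.comp (hentry i 0)).add (habs.comp (hentry j 1))).add
    (habs.comp ((hentry i 1).add (hentry j 0)))).add
    ((Metric.lipschitz_infDist_pt (vortexWells S)).comp ((hentry i 1).sub (hentry j 0))))
  exact h.weaken (by norm_num)

/-- The quasiconvex envelope of `vortexEnergy`. -/
noncomputable def vortexEnvelope (i j : Fin m) (S : Set ℕ) :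
    Matrix (Fin m) (Fin (k + 2)) ℝ → ℝ := qcEnvelope (vortexEnergy i j S)

lemma lipschitzWith_vortexEnvelope (i j : Fin m) (S : Set ℕ) :
    LipschitzWith 6 (vortexEnvelope (k := k) i j S) :=
  lipschitzWith_qcEnvelope (vortexEnergy_nonneg i j S) (lipschitzWith_vortexEnergy i j S)

lemma continuous_vortexEnvelope (i j : Fin m) (S : Set ℕ) :
    Continuous (vortexEnvelope (k := k) i j S) := (lipschitzWith_vortexEnvelope i j S).continuous

lemma isQuasiconvex_vortexEnvelope (i j : Fin m) (S : Set ℕ) :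
    IsQuasiconvex (vortexEnvelope (k := k) i j S) :=
  isQuasiconvex_qcEnvelope (vortexEnergy_nonneg i j S) (lipschitzWith_vortexEnergy i j S)

lemma hasLinearGrowth_vortexEnvelope (i j : Fin m) (S : Set ℕ) :
    HasLinearGrowth (vortexEnvelope (k := k) i j S) :=
  (lipschitzWith_vortexEnvelope i j S).hasLinearGrowth

lemma vortexEnvelope_rotation {i j : Fin m} (hij : i ≠ j) {S : Set ℕ} {l : ℕ} (hl : l ∉ S) :
    vortexEnvelope (k := k) i j S ((4 ^ l : ℝ) • rotationGenerator i j) = 0 :=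
  le_antisymm ((qcEnvelope_le_self (vortexEnergy_nonneg i j S) _).trans_eq
    (vortexEnergy_rotation hij hl)) (qcEnvelope_nonneg (vortexEnergy_nonneg i j S) _)

lemma le_vortexEnvelope {i j : Fin m} (hij : i ≠ j) {S : Set ℕ} {l : ℕ} (hl : l ∈ S) :
    4 ^ l / 600000 ≤ vortexEnvelope (k := k) i j S ((4 ^ l : ℝ) • rotationGenerator i j) := by
  refine le_ciInf fun ⟨φ, hφ⟩ => ?_
  have h4 : (0 : ℝ) < 4 ^ l := by positivity
  have hψ := hφ.const_smul (4 ^ l : ℝ)⁻¹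
  have h := le_integral_strainDefect hψ.contDiff_one hψ.tsupport_subset i j
  simp only [jacobianMatrix_const_smul hφ.differentiable] at h
  have hcont : Continuous fun x =>
      4 ^ l * strainDefect i j ((4 ^ l : ℝ)⁻¹ • jacobianMatrix φ x) := by
    have := fun a b => hφ.continuous_jacobian.matrix_elem a b
    simp only [strainDefect, Matrix.smul_apply]
    fun_prop
  refine le_trans ?_ (setIntegral_unitCube_mono hcont
    (hφ.continuous_comp_jacobian (lipschitzWith_vortexEnergy i j S).continuous _)
    fun x _ => le_vortexEnergy hij hl _)
  rw [integral_const_mul, div_eq_mul_one_div]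
  exact mul_le_mul_of_nonneg_left h h4.le

end

lemma abs_vortexEnvelope_sub {i j : Fin m} (hij : i ≠ j) {S T : Set ℕ} {l : ℕ} (hS : l ∈ S)
    (hT : l ∉ T) : 4 ^ l / 600000 ≤
      |vortexEnvelope (k := k) i j S ((4 ^ l : ℝ) • rotationGenerator i j) -
        vortexEnvelope (k := k) i j T ((4 ^ l : ℝ) • rotationGenerator i j)| := by
  rw [vortexEnvelope_rotation hij hT, sub_zero]
  exact (le_vortexEnvelope hij hS).trans (le_abs_self _)

theorem not_separable_of_two_le {D : Set (Matrix (Fin m) (Fin (k + 2)) ℝ → ℝ)} (hm : 2 ≤ m)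
    (hD : D.Countable) (hgrowth : ∀ g ∈ D, HasLinearGrowth g)
    (hdense : ∀ f : Matrix (Fin m) (Fin (k + 2)) ℝ → ℝ,
      Continuous f → IsQuasiconvex f → HasLinearGrowth f → ∀ ε > (0 : ℝ), ∃ g ∈ D, dLG f g < ε) :
    False := by
  obtain ⟨i, j, hij⟩ : ∃ i j : Fin m, i ≠ j := ⟨⟨0, by omega⟩, ⟨1, by omega⟩, by simp⟩
  set R : Matrix (Fin m) (Fin (k + 2)) ℝ := rotationGenerator i j
  have hR := frobNorm_nonneg R
  set c : ℝ := 1 / (600000 * (1 + frobNorm R)) / 2 with hc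
  have hc0 : 0 < c := by positivity
  choose g hgD hg using fun S : Set ℕ => hdense (vortexEnvelope i j S)
    (continuous_vortexEnvelope i j S) (isQuasiconvex_vortexEnvelope i j S)
    (hasLinearGrowth_vortexEnvelope i j S) c hc0
  have hsub : ∀ S T, g S = g T → S ⊆ T := by
    intro S T hST l hl
    by_contra hlT
    have h4 : (1 : ℝ) ≤ 4 ^ l := one_le_pow₀ (by norm_num)
    have h1 := abs_vortexEnvelope_sub (k := k) hij hl hlT
    have h2 := abs_sub_le_dLG (hasLinearGrowth_vortexEnvelope i j S) (hgrowth _ (hgD S))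
      ((4 ^ l : ℝ) • R)
    have h3 := abs_sub_le_dLG (hasLinearGrowth_vortexEnvelope i j T) (hgrowth _ (hgD T))
      ((4 ^ l : ℝ) • R)
    rw [← hST, abs_sub_comm] at h3
    have h5 : 1 + frobNorm ((4 ^ l : ℝ) • R) ≤ 4 ^ l * (1 + frobNorm R) := by
      rw [frobNorm_smul, abs_of_pos (by positivity)]
      linarith
    have hpos : 0 < 1 + frobNorm ((4 ^ l : ℝ) • R) := by
      linarith [frobNorm_nonneg ((4 ^ l : ℝ) • R)]
    have hgT := hg T
    rw [← hST] at hgT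
    have h6 := mul_lt_mul_of_pos_right (hg S) hpos
    have h7 := mul_lt_mul_of_pos_right hgT hpos
    have h8 := mul_le_mul_of_nonneg_left h5 hc0.le
    have h9 : c * (4 ^ l * (1 + frobNorm R)) = 4 ^ l / 600000 / 2 := by
      rw [hc]
      field_simp
    have h10 := abs_sub_le (vortexEnvelope i j S ((4 ^ l : ℝ) • R)) (g S ((4 ^ l : ℝ) • R))
      (vortexEnvelope i j T ((4 ^ l : ℝ) • R))
    linarith
  have hinj : Function.Injective fun S => (⟨g S, hgD S⟩ : D) := fun S T h =>
    have h' : g S = g T := congrArg Subtype.val h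
    Set.Subset.antisymm (hsub S T h') (hsub T S h'.symm)
  have := hD.to_subtype
  have hcount : Countable (Set ℕ) := hinj.countable
  obtain ⟨F, hF⟩ := exists_injective_nat (Set ℕ)
  exact Function.cantor_injective F hF

end VortexEnergy

section RankOne

/-- A modulated plane wave in the direction `ν` with amplitude direction `a`. -/
noncomputable def planeWave {m n : ℕ} (χ : (Fin n → ℝ) → ℝ) (a : Fin m → ℝ) (ν : Fin n → ℝ)
    (r ε τ : ℝ) : (Fin n → ℝ) → Fin m → ℝ :=
  fun x i => a i * (χ x * (r * ε * Real.sin (ε⁻¹ * ∑ j, x j * ν j + τ)))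

variable {m n : ℕ} {χ : (Fin n → ℝ) → ℝ}

lemma isTestMap_planeWave (hχ : ContDiff ℝ (⊤ : ℕ∞) χ) (hsupp : tsupport χ ⊆ unitCube n)
    (a : Fin m → ℝ) (ν : Fin n → ℝ) (r ε τ : ℝ) : IsTestMap (planeWave χ a ν r ε τ) where
  smooth := by
    refine contDiff_pi.2 fun i => contDiff_const.mul (hχ.mul (contDiff_const.mul ?_))
    exact Real.contDiff_sin.comp (by fun_prop)
  tsupport_subset := by
    refine (closure_mono fun x hx => ?_).trans hsupp
    contrapose! hx
    rw [Function.notMem_support] at hx ⊢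
    ext i
    simp [planeWave, hx]

lemma jacobianMatrix_planeWave (hχ : ContDiff ℝ (⊤ : ℕ∞) χ) (a : Fin m → ℝ) (ν : Fin n → ℝ)
    (r τ : ℝ) {ε : ℝ} (hε : ε ≠ 0) (x : Fin n → ℝ) (θ : ℝ) (hθ : θ = ε⁻¹ * ∑ j, x j * ν j + τ) :
    jacobianMatrix (planeWave χ a ν r ε τ) x =
      (χ x * (r * Real.cos θ)) • Matrix.vecMulVec a ν +
        (ε * (r * Real.sin θ)) • Matrix.vecMulVec a fun j => fderiv ℝ χ x (Pi.single j 1) := by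
  have hχd := (hχ.differentiable (by simp) x).hasFDerivAt
  have hlin : HasFDerivAt (fun x : Fin n → ℝ => ∑ j, x j * ν j)
      (∑ j, ν j • ContinuousLinearMap.proj (R := ℝ) (φ := fun _ : Fin n => ℝ) j) x := by
    refine HasFDerivAt.fun_sum fun j _ => ?_
    exact (hasFDerivAt_apply (𝕜 := ℝ) j x).mul_const (ν j)
  have hs := (((hlin.const_mul ε⁻¹).add_const τ).sin).const_mul (r * ε)
  rw [← hθ] at hs
  have hi : ∀ i, HasFDerivAt (fun x => planeWave χ a ν r ε τ x i) _ x := fun i =>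
    (hχd.mul hs).const_mul (a i)
  have hd : DifferentiableAt ℝ (planeWave χ a ν r ε τ) x :=
    differentiableAt_pi.2 fun i => (hi i).differentiableAt
  ext i j
  have := (hasFDerivAt_pi'.1 hd.hasFDerivAt i).unique (hi i)
  have h2 := DFunLike.congr_fun this (Pi.single j 1)
  simp only [ContinuousLinearMap.comp_apply, ContinuousLinearMap.proj_apply] at h2
  rw [jacobianMatrix, Matrix.of_apply, h2]
  simp [Matrix.vecMulVec_apply, Pi.single_apply, ← hθ]
  field_simp

lemma integral_unitCube_swap {a b : ℝ} {F : ℝ → (Fin n → ℝ) → ℝ}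
    (hF : Continuous (Function.uncurry F)) :
    ∫ τ in a..b, ∫ x in unitCube n, F τ x = ∫ x in unitCube n, ∫ τ in a..b, F τ x := by
  refine intervalIntegral_integral_swap ?_
  rw [Measure.prod_restrict, ← Measure.volume_eq_prod]
  exact (hF.continuousOn.integrableOn_compact (isCompact_uIcc.prod isCompact_Icc)).mono_set
    (Set.prod_mono Set.uIoc_subset_uIcc (unitCube_subset_Icc n))

/-- Averaging inequality along rank one directions. -/
lemma IsQuasiconvex.le_integral_rankOne {f : Matrix (Fin m) (Fin n) ℝ → ℝ} (hf : IsQuasiconvex f)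
    (hc : Continuous f) (hχ : ContDiff ℝ (⊤ : ℕ∞) χ) (hsupp : tsupport χ ⊆ unitCube n)
    (z : Matrix (Fin m) (Fin n) ℝ) (a : Fin m → ℝ) (ν : Fin n → ℝ) (r : ℝ) :
    2 * Real.pi * f z ≤ ∫ x in unitCube n, ∫ θ in (0 : ℝ)..(2 * Real.pi),
      f (z + (χ x * (r * Real.cos θ)) • Matrix.vecMulVec a ν) := by
  set G : ℝ → (Fin n → ℝ) → ℝ → ℝ := fun ε x θ =>
    f (z + ((χ x * (r * Real.cos θ)) • Matrix.vecMulVec a ν +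
        (ε * (r * Real.sin θ)) • Matrix.vecMulVec a fun j => fderiv ℝ χ x (Pi.single j 1))) with hG
  have hχc := hχ.continuous
  have hχd : ∀ j, Continuous fun x => fderiv ℝ χ x (Pi.single j 1) := fun j =>
    (hχ.continuous_fderiv (by simp)).clm_apply continuous_const
  have hGc : Continuous fun p : ℝ × (Fin n → ℝ) × ℝ => G p.1 p.2.1 p.2.2 := by
    refine hc.comp (continuous_const.add (Continuous.add ?_ ?_))
    · have : Continuous fun p : ℝ × (Fin n → ℝ) × ℝ => χ p.2.1 * (r * Real.cos p.2.2) := by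
        fun_prop
      exact this.smul continuous_const
    · have : Continuous fun p : ℝ × (Fin n → ℝ) × ℝ => p.1 * (r * Real.sin p.2.2) := by
        fun_prop
      refine this.smul ?_
      refine continuous_pi fun i => continuous_pi fun j => ?_
      simp only [Matrix.vecMulVec_apply]
      exact continuous_const.mul ((hχd j).comp (by fun_prop))
  have hinner : Continuous fun p : ℝ × (Fin n → ℝ) =>
      ∫ θ in (0 : ℝ)..(2 * Real.pi), G p.1 p.2 θ :=
    intervalIntegral.continuous_parametric_intervalIntegral_of_continuous'
      (f := fun (p : ℝ × (Fin n → ℝ)) θ => G p.1 p.2 θ)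
      (hGc.comp (f := fun q : (ℝ × (Fin n → ℝ)) × ℝ => (q.1.1, q.1.2, q.2)) (by fun_prop)) _ _
  have hH : Continuous fun ε => ∫ x in unitCube n, ∫ θ in (0 : ℝ)..(2 * Real.pi), G ε x θ :=
    continuous_integral_unitCube hinner
  have key : ∀ ε : ℝ, ε ≠ 0 → 2 * Real.pi * f z ≤
      ∫ x in unitCube n, ∫ θ in (0 : ℝ)..(2 * Real.pi), G ε x θ := by
    intro ε hε
    have h1 : ∀ τ : ℝ, f z ≤ ∫ x in unitCube n, G ε x (ε⁻¹ * ∑ j, x j * ν j + τ) := by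
      intro τ
      have ht := isTestMap_planeWave hχ hsupp a ν r ε τ
      refine (hf z _ ht.smooth ht.hasCompactSupport ht.tsupport_subset).trans_eq ?_
      congr 1
      funext x
      rw [jacobianMatrix_planeWave hχ a ν r τ hε x _ rfl]
    have hc2 : Continuous (Function.uncurry fun τ (x : Fin n → ℝ) =>
        G ε x (ε⁻¹ * ∑ j, x j * ν j + τ)) :=
      hGc.comp (f := fun q : ℝ × (Fin n → ℝ) => (ε, q.2, ε⁻¹ * ∑ j, q.2 j * ν j + q.1))
        (by fun_prop)
    calc 2 * Real.pi * f z = ∫ _τ in (0 : ℝ)..(2 * Real.pi), f z := by simp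
      _ ≤ ∫ τ in (0 : ℝ)..(2 * Real.pi),
          ∫ x in unitCube n, G ε x (ε⁻¹ * ∑ j, x j * ν j + τ) :=
        intervalIntegral.integral_mono_on Real.two_pi_pos.le (by simp)
          ((continuous_integral_unitCube hc2).intervalIntegrable _ _) fun τ _ => h1 τ
      _ = _ := by
        rw [integral_unitCube_swap hc2]
        congr 1
        funext x
        have hper : Function.Periodic (G ε x) (2 * Real.pi) := fun θ => by
          simp only [hG, Real.cos_add_two_pi, Real.sin_add_two_pi]
        rw [intervalIntegral.integral_comp_add_left (fun θ => G ε x θ), add_zero,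
          hper.intervalIntegral_add_eq _ 0, zero_add]
  have hlim : Filter.Tendsto (fun ε => ∫ x in unitCube n, ∫ θ in (0 : ℝ)..(2 * Real.pi), G ε x θ)
      (nhdsWithin 0 {0}ᶜ) (nhds (∫ x in unitCube n, ∫ θ in (0 : ℝ)..(2 * Real.pi), G 0 x θ)) :=
    (hH.tendsto 0).mono_left nhdsWithin_le_nhds
  have := ge_of_tendsto hlim (Filter.eventually_of_mem self_mem_nhdsWithin key)
  simpa [hG] using this

lemma eq_zero_of_integral_unitCube_nonpos {I : (Fin n → ℝ) → ℝ} (hI : Continuous I)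
    (h0 : ∀ x ∈ unitCube n, 0 ≤ I x) (h : ∫ x in unitCube n, I x ≤ 0) {x : Fin n → ℝ}
    (hx : x ∈ unitCube n) : I x = 0 := by
  have hm := measurableSet_unitCube n
  have hae : 0 ≤ᵐ[volume.restrict (unitCube n)] I := (ae_restrict_iff' hm).2 (.of_forall h0)
  have heq := (setIntegral_eq_zero_iff_of_nonneg_ae hae (integrableOn_unitCube hI)).1
    (le_antisymm h (setIntegral_nonneg hm h0))
  exact Measure.eqOn_open_of_ae_eq heq (isOpen_set_pi Set.finite_univ fun _ _ => isOpen_Ioo)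
    hI.continuousOn continuousOn_const hx

/-- A quasiconvex function is convex along rank one directions. -/
lemma IsQuasiconvex.le_chord {f : Matrix (Fin m) (Fin n) ℝ → ℝ} (hf : IsQuasiconvex f)
    (hc : Continuous f) (z : Matrix (Fin m) (Fin n) ℝ) (a : Fin m → ℝ) (ν : Fin n → ℝ) {t : ℝ}
    (ht : t ∈ Set.Icc (0 : ℝ) 1) : f (z + t • Matrix.vecMulVec a ν) ≤
      f z + t * (f (z + Matrix.vecMulVec a ν) - f z) := by
  set ξ := Matrix.vecMulVec a ν
  set β := f (z + ξ) - f z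
  set D : ℝ → ℝ := fun s => f (z + s • ξ) - (f z + s * β) with hD
  have hDc : Continuous D := by
    refine (hc.comp ?_).sub (by fun_prop)
    exact continuous_const.add (continuous_id.smul continuous_const)
  have hD0 : D 0 = 0 := by simp [hD]
  have hD1 : D 1 = 0 := by simp [hD, β]
  obtain ⟨t₀, ht₀, hmax⟩ := isCompact_Icc.exists_isMaxOn (Set.nonempty_Icc.2 zero_le_one)
    hDc.continuousOn
  suffices hle : D t₀ ≤ 0 by
    have := (hmax ht).trans hle
    simp only [hD] at this
    linarith
  by_contra! hpos
  have h0 : t₀ ≠ 0 := fun h => by rw [h, hD0] at hpos; exact hpos.false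
  have h1 : t₀ ≠ 1 := fun h => by rw [h, hD1] at hpos; exact hpos.false
  have ht0 : 0 < t₀ := lt_of_le_of_ne ht₀.1 h0.symm
  have ht1 : t₀ < 1 := lt_of_le_of_ne ht₀.2 h1
  set r := min t₀ (1 - t₀) with hr
  have hr0 : 0 < r := lt_min ht0 (by linarith)
  set x₀ : Fin n → ℝ := fun _ => 1 / 2
  have hx₀ : x₀ ∈ unitCube n := fun i _ => by norm_num [x₀]
  obtain ⟨χ, hsupp, -, hχ, hrange, hone⟩ := exists_contDiff_tsupport_subset (n := ⊤)
    ((isOpen_set_pi Set.finite_univ fun _ _ => isOpen_Ioo).mem_nhds hx₀ : unitCube n ∈ nhds x₀)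
  have hχc := hχ.continuous
  have hmem : ∀ x θ, t₀ + χ x * (r * Real.cos θ) ∈ Set.Icc (0 : ℝ) 1 := by
    intro x θ
    have hx : χ x ∈ Set.Icc (0 : ℝ) 1 := hrange ⟨x, rfl⟩
    have hb : |χ x * (r * Real.cos θ)| ≤ r := by
      rw [abs_mul, abs_mul, abs_of_nonneg hx.1, abs_of_pos hr0]
      have := Real.abs_cos_le_one θ
      have h2 : r * |Real.cos θ| ≤ r := mul_le_of_le_one_right hr0.le this
      exact (mul_le_of_le_one_left (by positivity) hx.2).trans h2
    rw [abs_le] at hb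
    constructor
    · linarith [min_le_left t₀ (1 - t₀)]
    · linarith [min_le_right t₀ (1 - t₀)]
  have hgap : ∀ x θ, 0 ≤ D t₀ - D (t₀ + χ x * (r * Real.cos θ)) := fun x θ =>
    sub_nonneg.2 (hmax (hmem x θ))
  have hgc : Continuous fun p : (Fin n → ℝ) × ℝ =>
      D t₀ - D (t₀ + χ p.1 * (r * Real.cos p.2)) :=
    continuous_const.sub (hDc.comp (by fun_prop))
  have hIc : Continuous fun x => ∫ θ in (0 : ℝ)..(2 * Real.pi),
      (D t₀ - D (t₀ + χ x * (r * Real.cos θ))) :=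
    intervalIntegral.continuous_parametric_intervalIntegral_of_continuous' hgc _ _
  have hfc : Continuous fun p : (Fin n → ℝ) × ℝ =>
      f (z + t₀ • ξ + (χ p.1 * (r * Real.cos p.2)) • ξ) := by
    have : Continuous fun p : (Fin n → ℝ) × ℝ => χ p.1 * (r * Real.cos p.2) := by fun_prop
    exact hc.comp (continuous_const.add (this.smul continuous_const))
  have hIeq : ∀ x, ∫ θ in (0 : ℝ)..(2 * Real.pi), (D t₀ - D (t₀ + χ x * (r * Real.cos θ))) =
      2 * Real.pi * f (z + t₀ • ξ) - ∫ θ in (0 : ℝ)..(2 * Real.pi),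
        f (z + t₀ • ξ + (χ x * (r * Real.cos θ)) • ξ) := by
    intro x
    have h2 : ∀ θ, D t₀ - D (t₀ + χ x * (r * Real.cos θ)) =
        (f (z + t₀ • ξ) + (χ x * r * β) * Real.cos θ) -
          f (z + t₀ • ξ + (χ x * (r * Real.cos θ)) • ξ) := by
      intro θ
      simp only [hD, add_smul, add_assoc]
      ring
    simp only [h2]
    rw [intervalIntegral.integral_sub, intervalIntegral.integral_add,
      intervalIntegral.integral_const_mul]
    · simp
    · simp
    · exact (by fun_prop : Continuous _).intervalIntegrable _ _
    · exact (by fun_prop : Continuous _).intervalIntegrable _ _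
    · exact (hfc.comp (f := fun θ : ℝ => (x, θ)) (by fun_prop)).intervalIntegrable _ _
  have hIle : ∫ x in unitCube n, ∫ θ in (0 : ℝ)..(2 * Real.pi),
      (D t₀ - D (t₀ + χ x * (r * Real.cos θ))) ≤ 0 := by
    simp only [hIeq]
    rw [integral_sub (integrableOn_unitCube continuous_const) (integrableOn_unitCube
      (intervalIntegral.continuous_parametric_intervalIntegral_of_continuous' hfc _ _))]
    have := hf.le_integral_rankOne hc hχ hsupp (z + t₀ • ξ) a ν r
    simp only [setIntegral_const, volume_real_unitCube, one_smul]
    linarith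
  have hI0 := eq_zero_of_integral_unitCube_nonpos hIc (fun x _ =>
    intervalIntegral.integral_nonneg Real.two_pi_pos.le fun θ _ => hgap x θ) hIle hx₀
  have hcontact : ∀ θ ∈ Set.Icc (0 : ℝ) (2 * Real.pi), D (t₀ + r * Real.cos θ) = D t₀ := by
    intro θ hθ
    by_contra hne
    have hp : 0 < D t₀ - D (t₀ + χ x₀ * (r * Real.cos θ)) := by
      refine lt_of_le_of_ne (hgap x₀ θ) fun h => hne ?_
      rw [hone, one_mul] at h
      linarith
    have := intervalIntegral.integral_pos Real.two_pi_pos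
      (hgc.comp (f := fun θ : ℝ => (x₀, θ)) (by fun_prop)).continuousOn
      (fun θ _ => hgap x₀ θ) ⟨θ, hθ, hp⟩
    exact this.ne' hI0
  have hA := hcontact 0 ⟨le_rfl, Real.two_pi_pos.le⟩
  have hB := hcontact Real.pi ⟨Real.pi_pos.le, by linarith [Real.pi_pos]⟩
  rw [Real.cos_zero, mul_one] at hA
  rw [Real.cos_pi, mul_neg, mul_one] at hB
  rcases min_choice t₀ (1 - t₀) with h | h
  · rw [hr, h, add_neg_cancel, hD0] at hB
    linarith
  · rw [hr, h, add_sub_cancel, hD1] at hA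
    linarith

end RankOne

/-- Any family of continuous functions on a proper space contains a countable subfamily that is
dense for uniform convergence on a given ball. -/
lemma exists_countable_dense_on_closedBall {E : Type*}
    [NormedAddCommGroup E] [ProperSpace E] (S : Set (E → ℝ)) (hS : ∀ f ∈ S, Continuous f) (R : ℝ) :
    ∃ T ⊆ S, T.Countable ∧
      ∀ f ∈ S, ∀ ε > 0, ∃ g ∈ T, ∀ z, ‖z‖ ≤ R → |f z - g z| ≤ ε := by
  have : CompactSpace (Metric.closedBall (0 : E) R) :=
    isCompact_iff_compactSpace.1 (isCompact_closedBall 0 R)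
  let ρ : S → C(Metric.closedBall (0 : E) R, ℝ) := fun f => ⟨fun z => f.1 z, by
    have := hS f.1 f.2
    fun_prop⟩
  obtain ⟨t, hts, htc, hdense⟩ :=
    (TopologicalSpace.IsSeparable.of_separableSpace (Set.range ρ)).exists_countable_dense_subset
  have := htc.to_subtype
  choose σ hσ using fun a : t => hts a.2
  refine ⟨Set.range fun a => (σ a : E → ℝ), ?_, Set.countable_range _, fun f hf ε hε => ?_⟩
  · rintro _ ⟨a, rfl⟩
    exact (σ a).2
  obtain ⟨a, hat, ha⟩ := Metric.mem_closure_iff.1 (hdense ⟨⟨f, hf⟩, rfl⟩) ε hε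
  refine ⟨_, ⟨⟨a, hat⟩, rfl⟩, fun z hz => ?_⟩
  have hz' : z ∈ Metric.closedBall (0 : E) R := by simpa using hz
  have ha : dist (ρ ⟨f, hf⟩) (ρ (σ ⟨a, hat⟩)) < ε := by rwa [hσ]
  exact (ContinuousMap.dist_apply_le_dist (f := ρ ⟨f, hf⟩) (g := ρ (σ ⟨a, hat⟩))
    ⟨z, hz'⟩).trans ha.le

section ConvexLinearGrowth

variable {E : Type*} [NormedAddCommGroup E] [NormedSpace ℝ E] {f g : E → ℝ}

/-- A convex function bounded by `C (1 + ‖z‖)` is `C`-Lipschitz. -/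
lemma ConvexOn.abs_sub_le_of_linear_growth (hf : ConvexOn ℝ Set.univ f) {C : ℝ} (hC : 0 ≤ C)
    (hgrowth : ∀ z, |f z| ≤ C * (1 + ‖z‖)) (x y : E) : |f x - f y| ≤ C * ‖x - y‖ := by
  have key : ∀ x y : E, f y - f x ≤ C * ‖y - x‖ := by
    intro x y
    refine le_of_forall_pos_le_add fun δ hδ => ?_
    set K := C * (1 + ‖x‖) + |f x| with hK
    have hK0 : 0 ≤ K := by positivity
    obtain ⟨T, hT⟩ := exists_nat_gt (max 1 (K / δ))
    have hT1 : (1 : ℝ) < T := (le_max_left _ _).trans_lt hT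
    have hT0 : (0 : ℝ) < T := by linarith
    have hKT : K < δ * T := by
      have := (le_max_right _ _).trans_lt hT
      rwa [div_lt_iff₀ hδ, mul_comm] at this
    have hinv : (T : ℝ)⁻¹ ≤ 1 := inv_le_one_of_one_le₀ hT1.le
    have hconv := hf.2 (Set.mem_univ x) (Set.mem_univ (x + (T : ℝ) • (y - x)))
      (sub_nonneg.2 hinv) (inv_nonneg.2 hT0.le) (by ring)
    have hpt : (1 - (T : ℝ)⁻¹) • x + (T : ℝ)⁻¹ • (x + (T : ℝ) • (y - x)) = y := by
      rw [smul_add, smul_smul, inv_mul_cancel₀ hT0.ne', sub_smul, one_smul, one_smul]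
      abel
    rw [hpt, smul_eq_mul, smul_eq_mul] at hconv
    have hnorm : ‖x + (T : ℝ) • (y - x)‖ ≤ ‖x‖ + T * ‖y - x‖ := by
      refine (norm_add_le _ _).trans_eq ?_
      rw [norm_smul, Real.norm_of_nonneg hT0.le]
    have hbound := (le_abs_self _).trans (hgrowth (x + (T : ℝ) • (y - x)))
    have hmul := mul_le_mul_of_nonneg_left hnorm hC
    have hscaled : T * (f y - f x) ≤ T * (C * ‖y - x‖ + δ) := by
      have : T * f y ≤ T * f x - f x + f (x + (T : ℝ) • (y - x)) := by
        have := mul_le_mul_of_nonneg_left hconv hT0.le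
        refine this.trans_eq ?_
        field_simp
      nlinarith [neg_abs_le (f x)]
    exact le_of_mul_le_mul_left hscaled hT0
  rw [abs_le]
  have h₁ := key x y
  have h₂ := key y x
  rw [norm_sub_rev] at h₁
  constructor <;> linarith

/-- `f` is, outside the ball of radius `R`, within relative error `ε` of the positively
homogeneous extension of its values on the sphere of radius `R`. -/
def IsAlmostRadial (f : E → ℝ) (R ε : ℝ) : Prop :=
  ∀ e : E, ‖e‖ = 1 → ∀ s, R ≤ s → |f (s • e) / s - f (R • e) / R| ≤ ε

lemma ConvexOn.slope_ray_mono (hf : ConvexOn ℝ Set.univ f) (e : E) {r s : ℝ} (hr : 0 < r)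
    (hrs : r ≤ s) : (f (r • e) - f 0) / r ≤ (f (s • e) - f 0) / s := by
  have hs : 0 < s := hr.trans_le hrs
  have h := hf.2 (Set.mem_univ (0 : E)) (Set.mem_univ (s • e))
    (sub_nonneg.2 ((div_le_one hs).2 hrs)) (div_nonneg hr.le hs.le) (by ring)
  rw [smul_zero, zero_add, smul_smul, div_mul_cancel₀ _ hs.ne', smul_eq_mul, smul_eq_mul] at h
  have h' := mul_le_mul_of_nonneg_left h hs.le
  have : s * ((1 - r / s) * f 0 + r / s * f (s • e)) = (s - r) * f 0 + r * f (s • e) := by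
    field_simp
  rw [div_le_div_iff₀ hr hs]
  linarith

lemma ConvexOn.exists_isAlmostRadial [ProperSpace E] (hf : ConvexOn ℝ Set.univ f) {C : ℝ}
    (hC : 0 ≤ C) (hgrowth : ∀ z, |f z| ≤ C * (1 + ‖z‖)) {ε : ℝ} (hε : 0 < ε) :
    ∃ R : ℕ, 1 ≤ R ∧ IsAlmostRadial f R ε := by
  have hlip := hf.abs_sub_le_of_linear_growth hC hgrowth
  set q : ℝ → E → ℝ := fun s e => (f (s • e) - f 0) / s with hq
  have hqlip : ∀ s, 0 < s → ∀ e e', |q s e - q s e'| ≤ C * ‖e - e'‖ := by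
    intro s hs e e'
    have : q s e - q s e' = (f (s • e) - f (s • e')) / s := by simp only [hq]; ring
    rw [this, abs_div, abs_of_pos hs, div_le_iff₀ hs]
    refine (hlip _ _).trans_eq ?_
    rw [← smul_sub, norm_smul, Real.norm_of_nonneg hs.le]
    ring
  have huniform : ∃ R₀ : ℝ, ∀ r, R₀ ≤ r → 0 < r → ∀ e ∈ Metric.sphere (0 : E) 1, ∀ s, r ≤ s →
      q s e - q r e ≤ ε / 2 := by
    refine (isCompact_sphere (0 : E) 1).induction_on
      (p := fun S => ∃ R₀ : ℝ, ∀ r, R₀ ≤ r → 0 < r → ∀ e ∈ S, ∀ s, r ≤ s →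
        q s e - q r e ≤ ε / 2) ⟨0, by simp⟩ ?_ ?_ ?_
    · rintro S T hST ⟨R₀, h⟩
      exact ⟨R₀, fun r hr hr0 e he => h r hr hr0 e (hST he)⟩
    · rintro S T ⟨R₁, h₁⟩ ⟨R₂, h₂⟩
      refine ⟨max R₁ R₂, fun r hr hr0 e he => ?_⟩
      rcases he with he | he
      · exact h₁ r ((le_max_left _ _).trans hr) hr0 e he
      · exact h₂ r ((le_max_right _ _).trans hr) hr0 e he
    · intro e₀ _
      set V := (fun s => q s e₀) '' Set.Ioi 0 with hV
      have hbdd : BddAbove V := by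
        refine ⟨C * ‖e₀‖, ?_⟩
        rintro _ ⟨s, hs, rfl⟩
        have hs : 0 < s := hs
        have := hqlip s hs e₀ 0
        simp only [hq, smul_zero, sub_self, zero_div, sub_zero] at this
        exact (le_abs_self _).trans this
      obtain ⟨_, ⟨R₀, hR₀, rfl⟩, hlt⟩ := exists_lt_of_lt_csSup
        (⟨_, Set.mem_image_of_mem _ (Set.mem_Ioi.2 one_pos)⟩ : V.Nonempty)
        (sub_lt_self (sSup V) (show 0 < ε / 4 by positivity))
      have hR₀ : 0 < R₀ := hR₀
      have hδ : 0 < ε / (8 * (C + 1)) := by positivity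
      refine ⟨_, mem_nhdsWithin_of_mem_nhds (Metric.ball_mem_nhds e₀ hδ), R₀, ?_⟩
      intro r hr hr0 e he s hs
      have hs0 : 0 < s := hr0.trans_le hs
      have hsV : q s e₀ ≤ sSup V := le_csSup hbdd ⟨s, hs0, rfl⟩
      have hmono : q R₀ e₀ ≤ q r e₀ := hf.slope_ray_mono e₀ hR₀ hr
      have h₁ := (le_abs_self _).trans (hqlip s hs0 e e₀)
      have h₂ := (neg_abs_le _).trans' (neg_le_neg (hqlip r hr0 e e₀))
      have hsmall : C * ‖e - e₀‖ ≤ ε / 8 := by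
        rw [Metric.mem_ball, dist_eq_norm, lt_div_iff₀ (by positivity)] at he
        nlinarith [norm_nonneg (e - e₀)]
      simp only at hlt
      linarith
  obtain ⟨R₀, hR₀⟩ := huniform
  obtain ⟨R, hR⟩ := exists_nat_gt (max (max 1 R₀) (4 * |f 0| / ε))
  have hR1 : (1 : ℝ) < R := ((le_max_left _ _).trans (le_max_left _ _)).trans_lt hR
  have hRR₀ : R₀ < R := ((le_max_right _ _).trans (le_max_left _ _)).trans_lt hR
  have hRf : 4 * |f 0| / ε < R := (le_max_right _ _).trans_lt hR
  have hRpos : (0 : ℝ) < R := by linarith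
  have hf0 : ∀ s, (R : ℝ) ≤ s → |f 0 / s| ≤ ε / 4 := by
    intro s hs
    have hs0 : 0 < s := hRpos.trans_le hs
    rw [abs_div, abs_of_pos hs0, div_le_iff₀ hs0]
    rw [div_lt_iff₀ hε] at hRf
    nlinarith
  refine ⟨R, by exact_mod_cast hR1.le, fun e he s hs => ?_⟩
  have h₁ := hR₀ R hRR₀.le hRpos e (by simpa using he) s hs
  have h₂ : q R e ≤ q s e := hf.slope_ray_mono e hRpos hs
  have h₃ := abs_le.1 (hf0 s hs)
  have h₄ := abs_le.1 (hf0 R le_rfl)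
  have h₅ : f (s • e) / s - f ((R : ℝ) • e) / R = q s e - q R e + (f 0 / s - f 0 / R) := by
    simp only [hq]; ring
  rw [h₅, abs_le]
  constructor <;> linarith [h₃.1, h₃.2, h₄.1, h₄.2]

lemma IsAlmostRadial.abs_sub_le {R ε : ℝ} (hR : 1 ≤ R) (hf : IsAlmostRadial f R ε)
    (hg : IsAlmostRadial g R ε) (hε : 0 ≤ ε) (h : ∀ z, ‖z‖ ≤ R → |f z - g z| ≤ ε) (z : E) :
    |f z - g z| ≤ 3 * ε * (1 + ‖z‖) := by
  rcases le_or_gt ‖z‖ R with hz | hz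
  · refine (h z hz).trans ?_
    nlinarith [norm_nonneg z, mul_nonneg hε (norm_nonneg z)]
  have hs : 0 < ‖z‖ := by linarith
  obtain ⟨e, he, hze⟩ : ∃ e : E, ‖e‖ = 1 ∧ z = ‖z‖ • e :=
    ⟨‖z‖⁻¹ • z, by rw [norm_smul, norm_inv, norm_norm, inv_mul_cancel₀ hs.ne'],
      by rw [smul_smul, mul_inv_cancel₀ hs.ne', one_smul]⟩
  have h₁ := hf e he _ hz.le
  have h₂ := hg e he _ hz.le
  have h₃ : |f (R • e) / R - g (R • e) / R| ≤ ε := by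
    rw [← sub_div, abs_div, abs_of_pos (by linarith : 0 < R), div_le_iff₀ (by linarith)]
    have := h (R • e) (by rw [norm_smul, he, Real.norm_of_nonneg (by linarith), mul_one])
    nlinarith
  rw [← hze] at h₁ h₂
  have h₄ : |f z / ‖z‖ - g z / ‖z‖| ≤ 3 * ε := by
    rw [abs_le] at *
    constructor <;> linarith [h₁.1, h₁.2, h₂.1, h₂.2, h₃.1, h₃.2]
  rw [← sub_div, abs_div, abs_of_pos hs, div_le_iff₀ hs] at h₄
  nlinarith

/-- Families of convex functions of linear growth are separable for the weighted sup metric. -/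
lemma exists_countable_dense_of_convexOn [ProperSpace E] (S : Set (E → ℝ))
    (hcont : ∀ f ∈ S, Continuous f) (hconv : ∀ f ∈ S, ConvexOn ℝ Set.univ f)
    (hgrowth : ∀ f ∈ S, ∃ C, 0 ≤ C ∧ ∀ z, |f z| ≤ C * (1 + ‖z‖)) :
    ∃ D ⊆ S, D.Countable ∧
      ∀ f ∈ S, ∀ ε > 0, ∃ g ∈ D, ∀ z, |f z - g z| ≤ ε * (1 + ‖z‖) := by
  choose T hTS hTc hT using fun p : ℕ × ℕ => exists_countable_dense_on_closedBall
    {f ∈ S | IsAlmostRadial f p.1 (1 / (p.2 + 1))} (fun f hf => hcont f hf.1) p.1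
  refine ⟨⋃ p, T p, Set.iUnion_subset fun p f hf => (hTS p hf).1, Set.countable_iUnion hTc, ?_⟩
  intro f hf ε hε
  obtain ⟨k, hk⟩ := exists_nat_one_div_lt (show 0 < ε / 3 by positivity)
  have hk0 : (0 : ℝ) < 1 / (k + 1) := Nat.one_div_pos_of_nat
  obtain ⟨C, hC, hfC⟩ := hgrowth f hf
  obtain ⟨R, hR, hfR⟩ := (hconv f hf).exists_isAlmostRadial hC hfC hk0
  obtain ⟨g, hg, hfg⟩ := hT (R, k) f ⟨hf, hfR⟩ _ hk0
  refine ⟨g, Set.mem_iUnion.2 ⟨_, hg⟩, fun z => ?_⟩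
  refine (hfR.abs_sub_le (by exact_mod_cast hR) (hTS _ hg).2 hk0.le hfg z).trans ?_
  gcongr
  linarith

end ConvexLinearGrowth

lemma IsQuasiconvex.convexOn {m n : ℕ} {f : Matrix (Fin m) (Fin n) ℝ → ℝ} (hf : IsQuasiconvex f)
    (hc : Continuous f) (h : min m n = 1) : ConvexOn ℝ Set.univ f := by
  have hrank : ∀ z : Matrix (Fin m) (Fin n) ℝ, ∃ a ν, z = Matrix.vecMulVec a ν := by
    intro z
    rcases min_choice m n with h' | h' <;> rw [h'] at h <;> subst h
    · exact ⟨fun _ => 1, z 0, by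
        ext i j; rw [Subsingleton.elim i 0]; simp [Matrix.vecMulVec_apply]⟩
    · exact ⟨fun i => z i 0, fun _ => 1, by
        ext i j; rw [Subsingleton.elim j 0]; simp [Matrix.vecMulVec_apply]⟩
  refine ⟨convex_univ, fun x _ y _ s t hs ht hst => ?_⟩
  obtain ⟨a, ν, hyx⟩ := hrank (y - x)
  obtain rfl : s = 1 - t := by linarith
  have key := hf.le_chord hc x a ν ⟨ht, by linarith⟩
  rw [← hyx, add_sub_cancel] at key
  have hpt : (1 - t) • x + t • y = x + t • (y - x) := by
    rw [sub_smul, one_smul, smul_sub]; abel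
  rw [hpt, smul_eq_mul, smul_eq_mul]
  linarith

section Frobenius

attribute [local instance] Matrix.frobeniusNormedAddCommGroup Matrix.frobeniusNormedSpace

lemma frobNorm_eq_norm {m n : ℕ} (z : Matrix (Fin m) (Fin n) ℝ) : frobNorm z = ‖z‖ := by
  rw [Matrix.frobenius_norm_def, frobNorm, Real.sqrt_eq_rpow]
  simp

lemma exists_countable_dense_quasiconvex {m n : ℕ} (h : min m n = 1) :
    ∃ D ⊆ {f : Matrix (Fin m) (Fin n) ℝ → ℝ |
        Continuous f ∧ IsQuasiconvex f ∧ HasLinearGrowth f}, D.Countable ∧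
      ∀ f ∈ {f | Continuous f ∧ IsQuasiconvex f ∧ HasLinearGrowth f}, ∀ ε > 0,
        ∃ g ∈ D, ∀ z, |f z - g z| ≤ ε * (1 + frobNorm z) := by
  simp only [frobNorm_eq_norm]
  refine exists_countable_dense_of_convexOn _ (fun f hf => hf.1)
    (fun f hf => hf.2.1.convexOn hf.1 h) fun f hf => ?_
  simpa only [HasLinearGrowth, frobNorm_eq_norm] using hf.2.2

end Frobenius

/-- The set of continuous quasiconvex functions of linear growth on `m×n` matrices is
separable for the metric `d(f,g) = sup_z |f(z)-g(z)|/(1+|z|)` if and only if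
`min(m,n) = 1`. -/
theorem quasiconvex_linear_growth_separable_iff (m n : ℕ) (hm : 1 ≤ m) (hn : 1 ≤ n) :
    (∃ D : Set (Matrix (Fin m) (Fin n) ℝ → ℝ), D.Countable ∧
      (∀ g ∈ D, Continuous g ∧ IsQuasiconvex g ∧ HasLinearGrowth g) ∧
      ∀ f : Matrix (Fin m) (Fin n) ℝ → ℝ,
        Continuous f → IsQuasiconvex f → HasLinearGrowth f →
        ∀ ε > (0 : ℝ), ∃ g ∈ D, dLG f g < ε) ↔ min m n = 1 := by
  constructor
  · rintro ⟨D, hDc, hD, hdense⟩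
    by_contra hmin
    obtain ⟨k, rfl⟩ : ∃ k, n = k + 2 := ⟨n - 2, by omega⟩
    exact not_separable_of_two_le (by omega) hDc (fun g hg => (hD g hg).2.2) hdense
  · intro h
    obtain ⟨D, hDS, hDc, hD⟩ := exists_countable_dense_quasiconvex h
    refine ⟨D, hDc, fun g hg => hDS hg, fun f hf hq hl ε hε => ?_⟩
    obtain ⟨g, hg, hfg⟩ := hD f ⟨hf, hq, hl⟩ (ε / 2) (half_pos hε)
    refine ⟨g, hg, (ciSup_le fun z => ?_).trans_lt (half_lt_self hε)⟩
    rw [div_le_iff₀ (by linarith [frobNorm_nonneg z])]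
    exact hfg z
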